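/- arXiv:1512.09211 — 3 statements merged into one kernel-verified Lean document; each statement's English description precedes it below -/
import Mathlib

section
/- Let |W⟩ = a₁|10…0⟩ + a₂|01…0⟩ + … + a_N|0…01⟩ be an N-qubit generalized W-class state on qubits A₁, …, A_N, with Σ_{i=1}^N |a_i|² = 1 and N ≥ 3. Then for all 1 ≤ i < j ≤ N, with I = {1,…,N} \ {i,j}: | Σ_{t∈I} [ C²(ρ_{A_iA_t}) − C²(ρ_{A_jA_t}) ] | ≤ C²(|W⟩_{A_iA_j | rest}) ≤ 2·C²(ρ_{A_iA_j}) + Σ_{t∈I} [ C²(ρ_{A_iA_t}) + C²(ρ_{A_jA_t}) ], where 'rest' denotes all qubits other than A_i, A_j and the ρ's are two-qubit reduced density matrices of |W⟩⟨W|. -/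
open scoped BigOperators

noncomputable section

/-- Partial trace over the second tensor factor:
`(ptraceRight ρ) s s' = ∑ t, ρ (s,t) (s',t)`. -/
def ptraceRight {S T : Type*} [Fintype S] [Fintype T]
    (ρ : Matrix (S × T) (S × T) ℂ) : Matrix S S ℂ :=
  fun s s' => ∑ t : T, ρ (s, t) (s', t)

/-- Partial trace over the first tensor factor. -/
def ptraceLeft {S T : Type*} [Fintype S] [Fintype T]
    (ρ : Matrix (S × T) (S × T) ℂ) : Matrix T T ℂ :=
  fun t t' => ∑ s : S, ρ (s, t) (s, t')

/-- The density matrix `|ψ⟩⟨ψ|` of a (pure) state vector `ψ`. -/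
def pureDM {d : Type*} (ψ : d → ℂ) : Matrix d d ℂ :=
  fun x y => ψ x * (starRingEnd ℂ) (ψ y)

/-- `Tr(ρ²)` (real part) of a square matrix. -/
def trSq {S : Type*} [Fintype S] (ρ : Matrix S S ℂ) : ℝ :=
  ((ρ * ρ).trace).re

/-- Linear entropy `T(ρ) = 1 - Tr(ρ²)`. -/
def linEnt {S : Type*} [Fintype S] (ρ : Matrix S S ℂ) : ℝ :=
  1 - trSq ρ

/-- Concurrence of a bipartite pure state `ψ : S × T → ℂ` (with respect to the
bipartition `S | T`): `C(ψ) = √(2 (1 - Tr ρ_S²))`. -/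
def pureConc {S T : Type*} [Fintype S] [Fintype T] (ψ : S × T → ℂ) : ℝ :=
  Real.sqrt (2 * (1 - trSq (ptraceRight (pureDM ψ))))

/-- The set of average pure-state concurrences over all finite pure-state
ensembles realizing the bipartite density matrix `ρ`. -/
def concSet {S T : Type*} [Fintype S] [Fintype T]
    (ρ : Matrix (S × T) (S × T) ℂ) : Set ℝ :=
  { c | ∃ (n : ℕ) (p : Fin n → ℝ) (φ : Fin n → S × T → ℂ),
      (∀ i, 0 ≤ p i) ∧ (∑ i, p i = 1) ∧
      (∀ i, ∑ x, ‖φ i x‖ ^ 2 = 1) ∧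
      (ρ = ∑ i, (p i : ℂ) • pureDM (φ i)) ∧
      c = ∑ i, p i * pureConc (φ i) }

/-- Concurrence of a bipartite mixed state (convex-roof extension). -/
def conc {S T : Type*} [Fintype S] [Fintype T]
    (ρ : Matrix (S × T) (S × T) ℂ) : ℝ :=
  sInf (concSet ρ)

/-- Concurrence of assistance of a bipartite mixed state. -/
def concA {S T : Type*} [Fintype S] [Fintype T]
    (ρ : Matrix (S × T) (S × T) ℂ) : ℝ :=
  sSup (concSet ρ)

/-- Concurrence of an `N`-qubit pure state `ψ` across the cut given by the
predicate `P` (the qubits satisfying `P` versus the rest). -/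
def qubitCut {N : ℕ} (P : Fin N → Prop) [DecidablePred P]
    (ψ : (Fin N → Fin 2) → ℂ) : ℝ :=
  pureConc (fun x : ({i // P i} → Fin 2) × ({i // ¬ P i} → Fin 2) =>
    ψ ((Equiv.piEquivPiSubtypeProd P (fun _ => Fin 2)).symm x))

/-- Assemble a full `N`-qubit configuration from values `x` at qubit `u`,
`y` at qubit `v`, and `f` elsewhere. -/
def assemble2 {N : ℕ} (u v : Fin N) (x y : Fin 2)
    (f : {i : Fin N // i ≠ u ∧ i ≠ v} → Fin 2) : Fin N → Fin 2 :=
  fun i => if h : i = u then x else if h' : i = v then y else f ⟨i, h, h'⟩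

/-- The two-qubit reduced density matrix of the `N`-qubit pure state `ψ` on the
(ordered) pair of qubits `u, v`, obtained by tracing out all other qubits. -/
def rdm2 {N : ℕ} (u v : Fin N) (ψ : (Fin N → Fin 2) → ℂ) :
    Matrix (Fin 2 × Fin 2) (Fin 2 × Fin 2) ℂ :=
  fun x y => ∑ f : {i : Fin N // i ≠ u ∧ i ≠ v} → Fin 2,
    ψ (assemble2 u v x.1 x.2 f) * (starRingEnd ℂ) (ψ (assemble2 u v y.1 y.2 f))

/-- The reduced density matrix of the `N`-qubit pure state `ψ` obtained by
tracing out the single qubit `v`, organized as a bipartite state on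
qubit `u` versus all remaining qubits. -/
def rdm1Rest {N : ℕ} (u v : Fin N) (ψ : (Fin N → Fin 2) → ℂ) :
    Matrix (Fin 2 × ({i : Fin N // i ≠ u ∧ i ≠ v} → Fin 2))
           (Fin 2 × ({i : Fin N // i ≠ u ∧ i ≠ v} → Fin 2)) ℂ :=
  fun x y => ∑ t : Fin 2,
    ψ (assemble2 u v x.1 t x.2) * (starRingEnd ℂ) (ψ (assemble2 u v y.1 t y.2))

/-- The unnormalised W-class vector `∑ k, a k • |0…01ₖ0…0⟩` on qubits indexed by `ι`. -/
def wVec {ι : Type*} [Fintype ι] [DecidableEq ι] (a : ι → ℂ) (f : ι → Fin 2) : ℂ :=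
  ∑ k, if f = (fun l => if l = k then 1 else 0) then a k else 0

lemma wVec_zero {ι : Type*} [Fintype ι] [DecidableEq ι] (a : ι → ℂ) : wVec a 0 = 0 := by
  refine Finset.sum_eq_zero fun k _ => if_neg fun h => ?_
  simpa using congrFun h k

lemma excitation_injective {ι : Type*} [DecidableEq ι] :
    Function.Injective (fun (k l : ι) => if l = k then (1 : Fin 2) else 0) := by
  intro k k' h
  by_contra hne
  simpa [hne] using congrFun h k

lemma wVec_excitation {ι : Type*} [Fintype ι] [DecidableEq ι] (a : ι → ℂ) (k : ι) :
    wVec a (fun l => if l = k then 1 else 0) = a k := by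
  unfold wVec
  rw [Finset.sum_eq_single k]
  · simp
  · intro b _ hb
    exact if_neg fun h => hb (excitation_injective h).symm
  · simp

lemma sum_norm_sq_wVec {ι : Type*} [Fintype ι] [DecidableEq ι] (a : ι → ℂ) :
    ∑ f, ‖wVec a f‖ ^ 2 = ∑ k, ‖a k‖ ^ 2 := by
  have h := Finset.sum_image (s := Finset.univ) (f := fun f => ‖wVec a f‖ ^ 2)
    (excitation_injective (ι := ι)).injOn
  simp only [wVec_excitation] at h
  rw [← h]
  symm
  refine Finset.sum_subset (Finset.subset_univ _) fun f _ hf => ?_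
  have : wVec a f = 0 := by
    refine Finset.sum_eq_zero fun k _ => if_neg fun h => hf ?_
    rw [h]
    exact Finset.mem_image_of_mem _ (Finset.mem_univ k)
  simp [this]

/-- The reduced state of `φ ⊗ |y₀⟩ + |x₀⟩ ⊗ χ` with `χ ⟂ |y₀⟩`. -/
lemma ptraceRight_pureDM_add {S T : Type*} [Fintype S] [Fintype T] [DecidableEq S]
    [DecidableEq T] (x₀ : S) (y₀ : T) (φ : S → ℂ) (χ : T → ℂ) (hχ : χ y₀ = 0) :
    ptraceRight (pureDM fun p : S × T =>
      (if p.2 = y₀ then φ p.1 else 0) + (if p.1 = x₀ then χ p.2 else 0)) =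
    fun s s' => φ s * (starRingEnd ℂ) (φ s') +
      if s = x₀ ∧ s' = x₀ then ((∑ t, ‖χ t‖ ^ 2 : ℝ) : ℂ) else 0 := by
  funext s s'
  have key : ∀ t, pureDM (fun p : S × T =>
      (if p.2 = y₀ then φ p.1 else 0) + (if p.1 = x₀ then χ p.2 else 0)) (s, t) (s', t) =
      (if t = y₀ then φ s * (starRingEnd ℂ) (φ s') else 0) +
        if s = x₀ ∧ s' = x₀ then ((‖χ t‖ ^ 2 : ℝ) : ℂ) else 0 := by
    intro t
    have h2 : χ t * (starRingEnd ℂ) (χ t) = ((‖χ t‖ ^ 2 : ℝ) : ℂ) := by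
      rw [Complex.mul_conj, Complex.normSq_eq_norm_sq]
    unfold pureDM
    rw [← h2]
    by_cases ht : t = y₀
    · subst ht; simp [hχ]
    · by_cases hs : s = x₀ <;> by_cases hs' : s' = x₀ <;> simp [ht, hs, hs']
  unfold ptraceRight
  simp only [key, Finset.sum_add_distrib]
  by_cases h : s = x₀ ∧ s' = x₀ <;> simp [h]

lemma trSq_eq_sum {S : Type*} [Fintype S] (M : Matrix S S ℂ) :
    trSq M = ∑ s, ∑ s', (M s s' * M s' s).re := by
  simp only [trSq, Matrix.trace, Matrix.diag, Matrix.mul_apply, Complex.re_sum]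

/-- `φ φ† + c |x₀⟩⟨x₀|` with `φ ⟂ |x₀⟩`. -/
lemma trSq_add_orthogonal {S : Type*} [Fintype S] [DecidableEq S] (x₀ : S) (φ : S → ℂ)
    (hφ : φ x₀ = 0) (c : ℝ) :
    trSq (fun s s' => φ s * (starRingEnd ℂ) (φ s') +
      if s = x₀ ∧ s' = x₀ then (c : ℂ) else 0 : Matrix S S ℂ) =
    (∑ s, ‖φ s‖ ^ 2) ^ 2 + c ^ 2 := by
  have key : ∀ s s', (φ s * (starRingEnd ℂ) (φ s') + if s = x₀ ∧ s' = x₀ then (c : ℂ) else 0) *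
      (φ s' * (starRingEnd ℂ) (φ s) + if s' = x₀ ∧ s = x₀ then (c : ℂ) else 0) =
      ((‖φ s‖ ^ 2 * ‖φ s'‖ ^ 2 : ℝ) : ℂ) +
        if s = x₀ then (if s' = x₀ then ((c ^ 2 : ℝ) : ℂ) else 0) else 0 := by
    intro s s'
    have h2 : ∀ z : ℂ, ((‖z‖ ^ 2 : ℝ) : ℂ) = z * (starRingEnd ℂ) z := fun z => by
      rw [Complex.mul_conj, Complex.normSq_eq_norm_sq]
    rw [Complex.ofReal_mul, h2, h2]
    by_cases hs : s = x₀
    · by_cases hs' : s' = x₀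
      · simp [hs, hs', hφ, sq]
      · simp [hs, hs', hφ]
    · simp [hs]; ring
  refine (trSq_eq_sum _).trans ?_
  simp only [key, Finset.sum_add_distrib, Complex.add_re]
  simp [sq, Finset.sum_mul_sum, apply_ite]

lemma wVec_piEquivPiSubtypeProd_symm {ι : Type*} [Fintype ι] [DecidableEq ι] (P : ι → Prop)
    [DecidablePred P] (a : ι → ℂ) (p : ({i // P i} → Fin 2) × ({i // ¬ P i} → Fin 2)) :
    wVec a ((Equiv.piEquivPiSubtypeProd P (fun _ => Fin 2)).symm p) =
      (if p.2 = 0 then wVec (fun k : {i // P i} => a k) p.1 else 0) +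
        (if p.1 = 0 then wVec (fun k : {i // ¬ P i} => a k) p.2 else 0) := by
  obtain ⟨x, y⟩ := p
  unfold wVec
  rw [← Fintype.sum_subtype_add_sum_subtype P, Finset.ite_sum_zero, Finset.ite_sum_zero]
  simp only [Equiv.symm_apply_eq, Equiv.piEquivPiSubtypeProd_apply, Prod.mk.injEq]
  congr 1 <;> refine Finset.sum_congr rfl fun k _ => ?_
  · have h : (fun l : {i // ¬ P i} => if (l : ι) = k then (1 : Fin 2) else 0) = 0 := by
      funext l
      exact if_neg fun (h : (l : ι) = k) => l.2 (h.symm ▸ k.2)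
    simp only [h, ← Subtype.ext_iff]
    simp only [and_comm (b := y = 0), ite_and]
  · have h : (fun l : {i // P i} => if (l : ι) = k then (1 : Fin 2) else 0) = 0 := by
      funext l
      exact if_neg fun (h : (l : ι) = k) => k.2 (h ▸ l.2)
    simp only [h, ← Subtype.ext_iff]
    rw [ite_and]

/-- The two-qubit vector `α |10⟩ + β |01⟩`. -/
def twoVec (α β : ℂ) (x : Fin 2 × Fin 2) : ℂ :=
  (if x = (1, 0) then α else 0) + (if x = (0, 1) then β else 0)

lemma sum_eq_add_add_sum_subtype_ne {N : ℕ} {M : Type*} [AddCommMonoid M] {u v : Fin N}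
    (h : u ≠ v) (g : Fin N → M) :
    ∑ k, g k = g u + g v + ∑ k : {i : Fin N // i ≠ u ∧ i ≠ v}, g k := by
  rw [← Finset.sum_pair h, ← Finset.sum_add_sum_compl {u, v} g]
  congr 1
  refine Finset.sum_subtype _ (fun x => ?_) g
  simp

lemma assemble2_eq_iff {N : ℕ} {u v : Fin N} (h : u ≠ v) (x y : Fin 2)
    (f : {i : Fin N // i ≠ u ∧ i ≠ v} → Fin 2) (g : Fin N → Fin 2) :
    assemble2 u v x y f = g ↔ x = g u ∧ y = g v ∧ f = fun l => g l.1 := by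
  constructor
  · rintro rfl
    refine ⟨by simp [assemble2], by simp [assemble2, h.symm], ?_⟩
    funext l
    simp [assemble2, l.2.1, l.2.2]
  · rintro ⟨rfl, rfl, rfl⟩
    funext l
    unfold assemble2
    split_ifs with h1 h2
    · rw [h1]
    · rw [h2]
    · rfl

lemma wVec_assemble2 {N : ℕ} {u v : Fin N} (h : u ≠ v) (a : Fin N → ℂ)
    (p : Fin 2 × Fin 2) (f : {i : Fin N // i ≠ u ∧ i ≠ v} → Fin 2) :
    wVec a (assemble2 u v p.1 p.2 f) =
      (if f = 0 then twoVec (a u) (a v) p else 0) +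
        (if p = (0, 0) then wVec (fun k : {i : Fin N // i ≠ u ∧ i ≠ v} => a k) f else 0) := by
  obtain ⟨x, y⟩ := p
  unfold wVec twoVec
  rw [sum_eq_add_add_sum_subtype_ne h]
  simp only [assemble2_eq_iff h, Prod.mk.injEq]
  congr 1
  · have h1 : (fun l : {i : Fin N // i ≠ u ∧ i ≠ v} => if (l : Fin N) = u then (1 : Fin 2) else 0)
        = 0 := by
      funext l; simp [l.2.1]
    have h2 : (fun l : {i : Fin N // i ≠ u ∧ i ≠ v} => if (l : Fin N) = v then (1 : Fin 2) else 0)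
        = 0 := by
      funext l; simp [l.2.2]
    by_cases hf : f = 0 <;> simp [h1, h2, h, h.symm, hf]
  · rw [Finset.ite_sum_zero]
    refine Finset.sum_congr rfl fun k _ => ?_
    simp only [if_neg k.2.1.symm, if_neg k.2.2.symm, ← Subtype.ext_iff, ← and_assoc]
    rw [ite_and]

lemma rdm2_wVec {N : ℕ} {u v : Fin N} (h : u ≠ v) (a : Fin N → ℂ) :
    rdm2 u v (wVec a) = fun s s' =>
      twoVec (a u) (a v) s * (starRingEnd ℂ) (twoVec (a u) (a v) s') +
        if s = (0, 0) ∧ s' = (0, 0) then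
          ((∑ k : {i : Fin N // i ≠ u ∧ i ≠ v}, ‖a k‖ ^ 2 : ℝ) : ℂ) else 0 := by
  have := ptraceRight_pureDM_add (0, 0) 0 (twoVec (a u) (a v))
    (wVec fun k : {i : Fin N // i ≠ u ∧ i ≠ v} => a k) (wVec_zero _)
  rw [sum_norm_sq_wVec] at this
  rw [← this]
  simp only [← wVec_assemble2 h]
  rfl

lemma pureConc_eq {ψ : Fin 2 × Fin 2 → ℂ} (hn : ∑ x, ‖ψ x‖ ^ 2 = 1) (h : ψ (1, 1) = 0) :
    pureConc ψ = 2 * (‖ψ (0, 1)‖ * ‖ψ (1, 0)‖) := by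
  have h2 : ∀ z : ℂ, ‖z‖ ^ 2 = z.re * z.re + z.im * z.im := fun z => by
    rw [← Complex.normSq_eq_norm_sq, Complex.normSq_apply]
  have key : 2 * (1 - trSq (ptraceRight (pureDM ψ))) = (2 * (‖ψ (0, 1)‖ * ‖ψ (1, 0)‖)) ^ 2 := by
    simp only [Fintype.sum_prod_type, Fin.sum_univ_two, h2, h] at hn
    simp only [mul_pow, h2]
    have : (1 : ℝ) = 1 ^ 2 := by norm_num
    rw [this]
    nth_rewrite 1 [← hn]
    simp [trSq, ptraceRight, pureDM, Matrix.trace, Matrix.mul_apply, Fin.sum_univ_two, h]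
    ring
  rw [pureConc, key, Real.sqrt_sq (by positivity)]

/-- The concurrence of `α |10⟩ + β |01⟩` mixed with `|00⟩`. -/
lemma conc_twoVec (α β : ℂ) (c : ℝ) (hc : 0 ≤ c) (hs : ‖α‖ ^ 2 + ‖β‖ ^ 2 + c = 1) :
    conc (fun s s' => twoVec α β s * (starRingEnd ℂ) (twoVec α β s') +
      if s = (0, 0) ∧ s' = (0, 0) then (c : ℂ) else 0) = 2 * (‖α‖ * ‖β‖) := by
  refine IsLeast.csInf_eq ⟨?_, ?_⟩
  · set s := ‖α‖ ^ 2 + ‖β‖ ^ 2 with hs_def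
    have hs0 : 0 ≤ s := by positivity
    let e : Fin 2 × Fin 2 → ℂ := fun x => if x = (0, 0) then 1 else 0
    have he : ∑ x, ‖e x‖ ^ 2 = 1 := by simp [e, Fintype.sum_prod_type]
    have he' : pureConc e = 0 := by
      rw [pureConc_eq he] <;> simp [e]
    by_cases hz : s = 0
    · have hα : α = 0 := by
        have : ‖α‖ ^ 2 = 0 := by nlinarith [sq_nonneg ‖α‖, sq_nonneg ‖β‖]
        simpa using this
      have hβ : β = 0 := by
        have : ‖β‖ ^ 2 = 0 := by nlinarith [sq_nonneg ‖α‖, sq_nonneg ‖β‖]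
        simpa using this
      have hc1 : c = 1 := by linarith
      refine ⟨1, fun _ => 1, fun _ => e, by simp, by simp, fun _ => he, ?_, by simp [he', hα]⟩
      ext x y
      by_cases hx : x = (0, 0) <;> by_cases hy : y = (0, 0) <;>
        simp [e, pureDM, twoVec, hα, hβ, hc1, hx, hy]
    · have hpos : 0 < s := lt_of_le_of_ne hs0 (Ne.symm hz)
      have hss : Real.sqrt s ≠ 0 := (Real.sqrt_pos.2 hpos).ne'
      have hss2 : (Real.sqrt s) ^ 2 = s := Real.sq_sqrt hs0
      let ψ : Fin 2 × Fin 2 → ℂ := fun x => ((Real.sqrt s)⁻¹ : ℝ) * twoVec α β x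
      have hψ : ∑ x, ‖ψ x‖ ^ 2 = 1 := by
        simp [ψ, twoVec, Fintype.sum_prod_type, mul_pow, hss2]
        rw [hs_def] at hz ⊢
        field_simp
        ring
      refine ⟨2, ![c, s], ![e, ψ], ?_, ?_, ?_, ?_, ?_⟩
      · intro i; fin_cases i <;> simp [hc, hs0]
      · simp; linarith
      · intro i; fin_cases i
        · exact he
        · exact hψ
      · have h1 : (s : ℂ) * (((Real.sqrt s)⁻¹ : ℝ) * ((Real.sqrt s)⁻¹ : ℝ)) = 1 := by
          norm_cast
          rw [← sq, inv_pow, hss2, mul_inv_cancel₀ hz]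
        ext x y
        have h2 : (s : ℂ) * (ψ x * (starRingEnd ℂ) (ψ y)) =
            twoVec α β x * (starRingEnd ℂ) (twoVec α β y) := by
          simp only [ψ, map_mul, Complex.conj_ofReal]
          linear_combination (twoVec α β x * (starRingEnd ℂ) (twoVec α β y)) * h1
        simp only [Fin.sum_univ_two, Matrix.add_apply, Matrix.smul_apply, pureDM, smul_eq_mul,
          Matrix.cons_val_zero, Matrix.cons_val_one, h2]
        by_cases hx : x = (0, 0) <;> by_cases hy : y = (0, 0) <;> simp [e, hx, hy, add_comm]
      · have : pureConc ψ = 2 * (‖α‖ * ‖β‖) / s := by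
          rw [pureConc_eq hψ (by simp [ψ, twoVec])]
          simp [ψ, twoVec, abs_of_nonneg]
          field_simp
          rw [hss2]
          ring
        simp [Fin.sum_univ_two, he', this]
        field_simp
  · rintro _ ⟨n, p, φ, hp, hp1, hφ, hρ, rfl⟩
    have h11 : ∀ k, p k * ‖φ k (1, 1)‖ ^ 2 = 0 := by
      have h := congrFun (congrFun hρ (1, 1)) (1, 1)
      have h' : ∑ k, p k * ‖φ k (1, 1)‖ ^ 2 = 0 := by
        simp [Matrix.sum_apply, twoVec, pureDM, Complex.mul_conj, Complex.normSq_eq_norm_sq] at h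
        exact_mod_cast h.symm
      intro k
      exact (Finset.sum_eq_zero_iff_of_nonneg
        (fun k _ => mul_nonneg (hp k) (sq_nonneg _))).1 h' k (Finset.mem_univ k)
    have h01 : β * (starRingEnd ℂ) α =
        ∑ k, (p k : ℂ) * (φ k (0, 1) * (starRingEnd ℂ) (φ k (1, 0))) := by
      have h := congrFun (congrFun hρ (0, 1)) (1, 0)
      simpa [Matrix.sum_apply, twoVec, pureDM] using h
    have hle : ‖α‖ * ‖β‖ ≤ ∑ k, p k * (‖φ k (0, 1)‖ * ‖φ k (1, 0)‖) := by
      calc ‖α‖ * ‖β‖ = ‖β * (starRingEnd ℂ) α‖ := by simp [mul_comm]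
        _ ≤ _ := by
          rw [h01]
          refine (norm_sum_le _ _).trans_eq (Finset.sum_congr rfl fun k _ => ?_)
          simp [abs_of_nonneg (hp k)]
    calc 2 * (‖α‖ * ‖β‖) ≤ 2 * ∑ k, p k * (‖φ k (0, 1)‖ * ‖φ k (1, 0)‖) := by linarith
      _ = ∑ k, p k * pureConc (φ k) := by
        rw [Finset.mul_sum]
        refine Finset.sum_congr rfl fun k _ => ?_
        rcases mul_eq_zero.1 (h11 k) with h | h
        · simp [h]
        · rw [pureConc_eq (hφ k) (by simpa using h)]
          ring

lemma conc_rdm2_wVec {N : ℕ} {u v : Fin N} (h : u ≠ v) (a : Fin N → ℂ)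
    (ha : ∑ k, ‖a k‖ ^ 2 = 1) : conc (rdm2 u v (wVec a)) = 2 * (‖a u‖ * ‖a v‖) := by
  rw [rdm2_wVec h]
  refine conc_twoVec _ _ _ (by positivity) ?_
  rw [← ha, sum_eq_add_add_sum_subtype_ne h]

lemma qubitCut_wVec_sq {N : ℕ} (P : Fin N → Prop) [DecidablePred P] (a : Fin N → ℂ)
    (ha : ∑ k, ‖a k‖ ^ 2 = 1) :
    (qubitCut P (wVec a)) ^ 2 =
      4 * ((∑ k : {i // P i}, ‖a k‖ ^ 2) * ∑ k : {i // ¬ P i}, ‖a k‖ ^ 2) := by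
  have hadd := Fintype.sum_subtype_add_sum_subtype P (fun k => ‖a k‖ ^ 2)
  rw [ha] at hadd
  unfold qubitCut pureConc
  simp only [wVec_piEquivPiSubtypeProd_symm]
  rw [ptraceRight_pureDM_add 0 0 (wVec fun k : {i // P i} => a k)
      (wVec fun k : {i // ¬ P i} => a k) (wVec_zero _),
    trSq_add_orthogonal 0 _ (wVec_zero _), sum_norm_sq_wVec, sum_norm_sq_wVec]
  have hx : 0 ≤ ∑ k : {i // P i}, ‖a k‖ ^ 2 := by positivity
  have hy : 0 ≤ ∑ k : {i // ¬ P i}, ‖a k‖ ^ 2 := by positivity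
  generalize ∑ k : {i // P i}, ‖a k‖ ^ 2 = X at *
  generalize ∑ k : {i // ¬ P i}, ‖a k‖ ^ 2 = Y at *
  have : 2 * (1 - (X ^ 2 + Y ^ 2)) = 4 * (X * Y) := by
    linear_combination (-2 * (X + Y + 1)) * hadd
  rw [this, Real.sq_sqrt (by positivity)]

/-- Generalized monogamy sandwich for the `N`-qubit generalized `W`-class state
`|W⟩ = ∑ k a_k |0…01_k0…0⟩` : for any pair of qubits `i < j`,
`|∑_{t ∉ {i,j}} (C²(ρ_{A_iA_t}) - C²(ρ_{A_jA_t}))| ≤ C²(W_{A_iA_j|rest})`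
`≤ 2 C²(ρ_{A_iA_j}) + ∑_{t ∉ {i,j}} (C²(ρ_{A_iA_t}) + C²(ρ_{A_jA_t}))`. -/
theorem wclass_generalized_monogamy_sandwich
    (N : ℕ) (hN : 3 ≤ N) (a : Fin N → ℂ) (ha : ∑ k, ‖a k‖ ^ 2 = 1)
    (W : (Fin N → Fin 2) → ℂ)
    (hW : W = fun f => ∑ k : Fin N,
      if f = (fun l => if l = k then 1 else 0) then a k else 0)
    (i j : Fin N) (hij : i < j) :
    |∑ t ∈ Finset.univ \ {i, j},
        ((conc (rdm2 i t W)) ^ 2 - (conc (rdm2 j t W)) ^ 2)| ≤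
      (qubitCut (fun k : Fin N => k = i ∨ k = j) W) ^ 2 ∧
    (qubitCut (fun k : Fin N => k = i ∨ k = j) W) ^ 2 ≤
      2 * (conc (rdm2 i j W)) ^ 2 +
        ∑ t ∈ Finset.univ \ {i, j},
          ((conc (rdm2 i t W)) ^ 2 + (conc (rdm2 j t W)) ^ 2) := by
  have hij' : i ≠ j := hij.ne
  obtain rfl : W = wVec a := hW
  set S : Finset (Fin N) := Finset.univ \ {i, j} with hS
  have hcut : (qubitCut (fun k : Fin N => k = i ∨ k = j) (wVec a)) ^ 2 =
      4 * ((‖a i‖ ^ 2 + ‖a j‖ ^ 2) * ∑ t ∈ S, ‖a t‖ ^ 2) := by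
    rw [qubitCut_wVec_sq _ _ ha, ← Finset.sum_pair (f := fun k => ‖a k‖ ^ 2) hij',
      Finset.sum_subtype {i, j} (p := fun k => k = i ∨ k = j) (by simp) (fun k => ‖a k‖ ^ 2),
      Finset.sum_subtype S (p := fun k => ¬ (k = i ∨ k = j)) (by simp [hS]) (fun k => ‖a k‖ ^ 2)]
  have hi : ∀ t ∈ S, conc (rdm2 i t (wVec a)) = 2 * (‖a i‖ * ‖a t‖) := fun t ht =>
    conc_rdm2_wVec (by rintro rfl; simp [hS] at ht) a ha
  have hj : ∀ t ∈ S, conc (rdm2 j t (wVec a)) = 2 * (‖a j‖ * ‖a t‖) := fun t ht =>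
    conc_rdm2_wVec (by rintro rfl; simp [hS] at ht) a ha
  have hsub : ∑ t ∈ S, ((conc (rdm2 i t (wVec a))) ^ 2 - (conc (rdm2 j t (wVec a))) ^ 2) =
      4 * ((‖a i‖ ^ 2 - ‖a j‖ ^ 2) * ∑ t ∈ S, ‖a t‖ ^ 2) := by
    rw [Finset.mul_sum, Finset.mul_sum]
    refine Finset.sum_congr rfl fun t ht => ?_
    rw [hi t ht, hj t ht]
    ring
  have hadd : ∑ t ∈ S, ((conc (rdm2 i t (wVec a))) ^ 2 + (conc (rdm2 j t (wVec a))) ^ 2) =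
      4 * ((‖a i‖ ^ 2 + ‖a j‖ ^ 2) * ∑ t ∈ S, ‖a t‖ ^ 2) := by
    rw [Finset.mul_sum, Finset.mul_sum]
    refine Finset.sum_congr rfl fun t ht => ?_
    rw [hi t ht, hj t ht]
    ring
  rw [hcut, hsub, hadd]
  have hr : 0 ≤ ∑ t ∈ S, ‖a t‖ ^ 2 := by positivity
  refine ⟨?_, le_add_of_nonneg_left (by positivity)⟩
  rw [abs_le]
  constructor <;> nlinarith [mul_nonneg (sq_nonneg ‖a i‖) hr, mul_nonneg (sq_nonneg ‖a j‖) hr]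

end
end

section
/- Let |W⟩ = a₁|10…0⟩ + a₂|01…0⟩ + … + a_N|0…01⟩ be an N-qubit generalized W-class state on qubits A₁, …, A_N, with Σ_{i=1}^N |a_i|² = 1. Then for every pair of distinct indices p ≠ q, the two-qubit reduced density matrix ρ_{A_pA_q} satisfies C(ρ_{A_pA_q}) = C_a(ρ_{A_pA_q}), i.e. its concurrence equals its concurrence of assistance. -/
open scoped BigOperators

noncomputable section

/-- For a normalized two-qubit vector without `|11⟩` component, the concurrence is
`2 |ψ₀₁| |ψ₁₀|`. -/
theorem pureConc_of_apply_one_one_eq_zero (ψ : Fin 2 × Fin 2 → ℂ)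
    (hψ : ∑ x, ‖ψ x‖ ^ 2 = 1) (h : ψ (1, 1) = 0) :
    pureConc ψ = 2 * (‖ψ (0, 1)‖ * ‖ψ (1, 0)‖) := by
  have hsq : 2 * (1 - trSq (ptraceRight (pureDM ψ))) =
      (2 * (‖ψ (0, 1)‖ * ‖ψ (1, 0)‖)) ^ 2 := by
    have h1 : (1 : ℝ) = (∑ x, ‖ψ x‖ ^ 2) ^ 2 := by rw [hψ, one_pow]
    rw [h1]
    simp only [trSq, Matrix.trace, Matrix.diag, Matrix.mul_apply, ptraceRight, pureDM,
      Fintype.sum_prod_type, Fin.sum_univ_two, h, mul_pow, Complex.sq_norm, Complex.normSq_apply,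
      Complex.add_re, Complex.mul_re, Complex.add_im, Complex.mul_im, Complex.conj_re,
      Complex.conj_im, Complex.zero_re, Complex.zero_im]
    ring
  rw [pureConc, hsq, Real.sqrt_sq (by positivity)]

open ComplexConjugate in
/-- The quadratic form of an ensemble average on the span of two basis vectors. -/
theorem sum_mul_norm_sub_sq {d ι : Type*} [Fintype ι] (p : ι → ℝ) (φ : ι → d → ℂ)
    (ρ : Matrix d d ℂ) (hρ : ρ = ∑ i, (p i : ℂ) • pureDM (φ i)) (x y : d) (z w : ℂ) :
    ((∑ i, p i * ‖z * φ i x - w * φ i y‖ ^ 2 : ℝ) : ℂ) =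
      z * conj z * ρ x x - z * conj w * ρ x y - w * conj z * ρ y x + w * conj w * ρ y y := by
  subst hρ
  simp only [Matrix.sum_apply, Matrix.smul_apply, pureDM, smul_eq_mul, Finset.mul_sum,
    ← Finset.sum_sub_distrib, ← Finset.sum_add_distrib, Complex.ofReal_sum]
  refine Finset.sum_congr rfl fun i _ => ?_
  rw [Complex.ofReal_mul, Complex.ofReal_pow, ← Complex.mul_conj']
  simp only [map_sub, map_mul]
  ring

theorem sum_mul_norm_sq {d ι : Type*} [Fintype ι] (p : ι → ℝ) (φ : ι → d → ℂ)
    (ρ : Matrix d d ℂ) (hρ : ρ = ∑ i, (p i : ℂ) • pureDM (φ i)) (x : d) :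
    ((∑ i, p i * ‖φ i x‖ ^ 2 : ℝ) : ℂ) = ρ x x := by
  simpa using sum_mul_norm_sub_sq p φ ρ hρ x x 1 0

open ComplexConjugate in
/-- If a two-qubit state vanishes on `|11⟩` and restricts to the rank-one operator of
`β|01⟩ + α|10⟩` on the single-excitation space, all its pure-state ensembles have the same
average concurrence. -/
theorem eq_of_mem_concSet {ρ : Matrix (Fin 2 × Fin 2) (Fin 2 × Fin 2) ℂ} {α β : ℂ}
    (h11 : ρ (1, 1) (1, 1) = 0)
    (h01 : ρ (0, 1) (0, 1) = β * conj β) (h10 : ρ (1, 0) (1, 0) = α * conj α)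
    (hoff : ρ (0, 1) (1, 0) = β * conj α) (hoff' : ρ (1, 0) (0, 1) = α * conj β)
    {c : ℝ} (hc : c ∈ concSet ρ) : c = 2 * (‖α‖ * ‖β‖) := by
  obtain ⟨n, p, φ, hp, -, hφ, hρ, rfl⟩ := hc
  have eq_zero (v : Fin n → ℂ) (hv : ∑ i, p i * ‖v i‖ ^ 2 = 0) (i : Fin n) (hi : p i ≠ 0) :
      v i = 0 := by
    have := (Finset.sum_eq_zero_iff_of_nonneg fun i _ =>
      mul_nonneg (hp i) (sq_nonneg ‖v i‖)).1 hv i (Finset.mem_univ i)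
    simpa [hi] using this
  have z11 := eq_zero (fun i => φ i (1, 1)) <| by
    exact_mod_cast (sum_mul_norm_sq p φ ρ hρ (1, 1)).trans h11
  have prop := eq_zero (fun i => α * φ i (0, 1) - β * φ i (1, 0)) <| by
    have := sum_mul_norm_sub_sq p φ ρ hρ (0, 1) (1, 0) α β
    rw [h01, h10, hoff, hoff'] at this
    have h0 : α * conj α * (β * conj β) - α * conj β * (β * conj α) - β * conj α * (α * conj β) +
      β * conj β * (α * conj α) = 0 := by ring
    exact_mod_cast this.trans h0
  have s10 : ∑ i, p i * ‖φ i (1, 0)‖ ^ 2 = ‖α‖ ^ 2 := by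
    have := (sum_mul_norm_sq p φ ρ hρ (1, 0)).trans h10
    rw [Complex.mul_conj'] at this
    exact_mod_cast this
  have hsum : ∑ i, p i * pureConc (φ i) =
      ∑ i, p i * (2 * (‖φ i (0, 1)‖ * ‖φ i (1, 0)‖)) := by
    refine Finset.sum_congr rfl fun i _ => ?_
    by_cases hi : p i = 0
    · simp [hi]
    · rw [pureConc_of_apply_one_one_eq_zero _ (hφ i) (z11 i hi)]
  rw [hsum]
  by_cases hα : α = 0
  · have z10 := eq_zero (fun i => φ i (1, 0)) (by simp [s10, hα])
    rw [hα, norm_zero, zero_mul, mul_zero]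
    refine Finset.sum_eq_zero fun i _ => ?_
    by_cases hi : p i = 0
    · simp [hi]
    · simp [z10 i hi]
  · apply mul_left_cancel₀ (norm_ne_zero_iff.2 hα)
    calc ‖α‖ * ∑ i, p i * (2 * (‖φ i (0, 1)‖ * ‖φ i (1, 0)‖))
        = 2 * ‖β‖ * ∑ i, p i * ‖φ i (1, 0)‖ ^ 2 := by
          rw [Finset.mul_sum, Finset.mul_sum]
          refine Finset.sum_congr rfl fun i _ => ?_
          by_cases hi : p i = 0
          · simp [hi]
          · have hn : ‖α‖ * ‖φ i (0, 1)‖ = ‖β‖ * ‖φ i (1, 0)‖ := by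
              rw [← norm_mul, ← norm_mul, sub_eq_zero.1 (prop i hi)]
            linear_combination 2 * p i * ‖φ i (1, 0)‖ * hn
      _ = ‖α‖ * (2 * (‖α‖ * ‖β‖)) := by rw [s10]; ring

/-- The amplitude vector of the generalized `W`-class state with coefficients `a`. -/
def wState {N : ℕ} (a : Fin N → ℂ) : (Fin N → Fin 2) → ℂ := fun f => ∑ k : Fin N,
  if f = (fun l => if l = k then 1 else 0) then a k else 0

theorem wState_assemble2_one_one {N : ℕ} (a : Fin N → ℂ) {u v : Fin N} (huv : u ≠ v)
    (f : {i : Fin N // i ≠ u ∧ i ≠ v} → Fin 2) : wState a (assemble2 u v 1 1 f) = 0 := by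
  refine Finset.sum_eq_zero fun k _ => if_neg fun h => huv ?_
  have hu := congrFun h u
  have hv := congrFun h v
  simp only [assemble2, dite_true, dif_neg huv.symm] at hu hv
  have hu' : u = k := by by_contra hk; simp [hk] at hu
  have hv' : v = k := by by_contra hk; simp [hk] at hv
  exact hu'.trans hv'.symm

theorem wState_assemble2_one_zero {N : ℕ} (a : Fin N → ℂ) {u v : Fin N}
    (f : {i : Fin N // i ≠ u ∧ i ≠ v} → Fin 2) :
    wState a (assemble2 u v 1 0 f) = if f = 0 then a u else 0 := by
  have key (k : Fin N) : assemble2 u v 1 0 f = (fun l => if l = k then 1 else 0) ↔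
      u = k ∧ f = 0 := by
    constructor
    · intro h
      have hu := congrFun h u
      simp only [assemble2, dite_true] at hu
      have hk : u = k := by by_contra hk; simp [hk] at hu
      refine ⟨hk, funext fun i => ?_⟩
      have := congrFun h i
      simpa [assemble2, i.2.1, i.2.2, ← hk] using this
    · rintro ⟨rfl, rfl⟩
      ext l
      by_cases hl : l = u <;> simp [assemble2, hl]
  simp only [wState, key, ite_and, Finset.sum_ite_eq, Finset.mem_univ, if_true]

theorem assemble2_swap {N : ℕ} {u v : Fin N} (huv : u ≠ v) (x y : Fin 2)
    (f : {i : Fin N // i ≠ u ∧ i ≠ v} → Fin 2) :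
    assemble2 u v x y f = assemble2 v u y x fun i => f ⟨i, i.2.2, i.2.1⟩ := by
  ext l
  by_cases hu : l = u
  · subst hu; simp [assemble2, huv]
  · simp [assemble2, hu]

theorem wState_assemble2_zero_one {N : ℕ} (a : Fin N → ℂ) {u v : Fin N} (huv : u ≠ v)
    (f : {i : Fin N // i ≠ u ∧ i ≠ v} → Fin 2) :
    wState a (assemble2 u v 0 1 f) = if f = 0 then a v else 0 := by
  rw [assemble2_swap huv, wState_assemble2_one_zero a]
  refine if_congr ⟨fun h => funext fun i => ?_, fun h => by subst h; rfl⟩ rfl rfl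
  exact congrFun h ⟨i, i.2.2, i.2.1⟩

/-- For the `N`-qubit generalized `W`-class state, the concurrence of every
two-qubit reduced density matrix equals its concurrence of assistance. -/
theorem wclass_conc_eq_concA
    (N : ℕ) (a : Fin N → ℂ) (ha : ∑ k, ‖a k‖ ^ 2 = 1)
    (W : (Fin N → Fin 2) → ℂ)
    (hW : W = fun f => ∑ k : Fin N,
      if f = (fun l => if l = k then 1 else 0) then a k else 0)
    (p q : Fin N) (hpq : p ≠ q) :
    conc (rdm2 p q W) = concA (rdm2 p q W) := by
  have hW' : W = wState a := hW
  have key : ∀ c ∈ concSet (rdm2 p q W), c = 2 * (‖a p‖ * ‖a q‖) := by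
    rw [hW']
    intro c hc
    refine eq_of_mem_concSet ?_ ?_ ?_ ?_ ?_ hc <;>
      simp [rdm2, wState_assemble2_one_one a hpq, wState_assemble2_one_zero a,
        wState_assemble2_zero_one a hpq]
  rcases (Set.subset_singleton_iff_eq.1 key : concSet (rdm2 p q W) = ∅ ∨ _) with h | h <;>
    simp [conc, concA, h]

end
end

section
/- Corollary 1: Let N ≥ 4 and let |ψ⟩ be an N-qubit pure state on qubits A, B, C₁, C₂, …, C_{N−2}. Then C²(|ψ⟩_{ABC₁|C₂…C_{N−2}}) ≥ max{ Σ_{i=1}^{N−2} C²(ρ_{AC_i}) − Σ_{i=1}^{N−2} C_a²(ρ_{BC_i}), Σ_{i=1}^{N−2} C²(ρ_{BC_i}) − Σ_{i=1}^{N−2} C_a²(ρ_{AC_i}) } − Σ_{j∈J} C_a²(ρ_{C₁ j}), where J = {A, B, C₂, …, C_{N−2}} and ρ_{C₁ j} is the two-qubit reduced density matrix of |ψ⟩⟨ψ| on qubits C₁ and j. -/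
open scoped BigOperators

noncomputable section

theorem isCompact_unitaryGroup (n : Type*) [Fintype n] [DecidableEq n] :
    IsCompact (Matrix.unitaryGroup n ℂ : Set (Matrix n n ℂ)) := by
  refine IsCompact.of_isClosed_subset
    (isCompact_univ_pi fun _ : n => isCompact_univ_pi fun _ : n =>
      isCompact_closedBall (0 : ℂ) 1) ?_ ?_
  · have : (Matrix.unitaryGroup n ℂ : Set (Matrix n n ℂ)) = {U | U * star U = 1} := by
      ext U; exact Matrix.mem_unitaryGroup_iff
    rw [this]
    exact isClosed_eq (by fun_prop) continuous_const
  · intro U hU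
    exact fun i _ j _ => mem_closedBall_zero_iff.mpr (entry_norm_bound_of_unitary hU i j)

instance (n : Type*) [Fintype n] [DecidableEq n] : CompactSpace (Matrix.unitaryGroup n ℂ) :=
  isCompact_iff_compactSpace.mp (isCompact_unitaryGroup n)

theorem exists_unit_sq_mul_eq_norm (w : ℂ) : ∃ z : ℂ, ‖z‖ = 1 ∧ z * w * z = (‖w‖ : ℂ) := by
  refine ⟨Complex.exp (-(w.arg / 2 : ℝ) * Complex.I), ?_, ?_⟩
  · rw [← Complex.ofReal_neg, Complex.norm_exp_ofReal_mul_I]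
  · nth_rewrite 2 [← Complex.norm_mul_exp_arg_mul_I w]
    rw [mul_comm, ← mul_assoc, mul_left_comm, ← Complex.exp_add, ← Complex.exp_add]
    push_cast
    rw [show -(w.arg / 2 : ℂ) * Complex.I + -(w.arg / 2 : ℂ) * Complex.I + w.arg * Complex.I = 0
      by ring]
    simp

theorem exists_orthogonal_diagonal {n : Type*} [Fintype n] [DecidableEq n] (B : Matrix n n ℝ)
    (hB : B.transpose = B) :
    ∃ O : Matrix n n ℝ, O * O.transpose = 1 ∧ O.transpose * O = 1 ∧ ∃ d : n → ℝ,
      O * B * O.transpose = Matrix.diagonal d := by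
  have hB' : B.IsHermitian := by
    rw [Matrix.IsHermitian, Matrix.conjTranspose_eq_transpose_of_trivial, hB]
  have h := hB'.conjStarAlgAut_star_eigenvectorUnitary
  rw [Unitary.conjStarAlgAut_apply] at h
  have h1 := hB'.eigenvectorUnitary.2
  refine ⟨star (hB'.eigenvectorUnitary : Matrix n n ℝ), ?_, ?_, hB'.eigenvalues, ?_⟩
  · have := Matrix.mem_unitaryGroup_iff'.mp h1
    simpa [Matrix.star_eq_conjTranspose, Matrix.conjTranspose_eq_transpose_of_trivial] using this
  · have := Matrix.mem_unitaryGroup_iff.mp h1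
    simpa [Matrix.star_eq_conjTranspose, Matrix.conjTranspose_eq_transpose_of_trivial] using this
  · simpa [Matrix.star_eq_conjTranspose, Matrix.conjTranspose_eq_transpose_of_trivial,
      Function.comp_def] using h

theorem map_ofReal_mem_unitaryGroup {n : Type*} [Fintype n] [DecidableEq n] {O : Matrix n n ℝ}
    (hO : O * O.transpose = 1) :
    O.map Complex.ofReal ∈ Matrix.unitaryGroup n ℂ := by
  have h : star (O.map Complex.ofReal) = O.transpose.map Complex.ofReal := by
    ext i j; simp [Matrix.star_apply]
  have := congrArg (fun M => M.map (Complex.ofRealHom)) hO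
  simp only [Matrix.map_mul] at this
  rw [Matrix.mem_unitaryGroup_iff, h]
  refine this.trans ?_
  ext i j; by_cases hij : i = j <;> simp [Matrix.one_apply, hij]

theorem diagonal_mem_unitaryGroup {n : Type*} [Fintype n] [DecidableEq n] {z : n → ℂ}
    (hz : ∀ i, ‖z i‖ = 1) : Matrix.diagonal z ∈ Matrix.unitaryGroup n ℂ := by
  rw [Matrix.mem_unitaryGroup_iff, Matrix.star_eq_conjTranspose, Matrix.diagonal_conjTranspose,
    Matrix.diagonal_mul_diagonal, ← Matrix.diagonal_one]
  congr 1; ext i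
  simp [Complex.mul_conj, Complex.normSq_eq_norm_sq, hz]

/-- Autonne–Takagi factorization of a complex symmetric matrix. -/
theorem takagi {n : Type*} [Fintype n] [DecidableEq n] (τ : Matrix n n ℂ)
    (hτ : τ.transpose = τ) :
    ∃ U ∈ Matrix.unitaryGroup n ℂ, ∃ d : n → ℝ, (∀ i, 0 ≤ d i) ∧
      U * τ * U.transpose = Matrix.diagonal (fun i => (d i : ℂ)) := by
  obtain ⟨U, hU, hmax⟩ := (isCompact_unitaryGroup n).exists_isMaxOn ⟨1, one_mem _⟩
    (f := fun U => ((U * τ * U.transpose).trace).re) (by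
      apply Continuous.continuousOn; fun_prop)
  set σ := U * τ * U.transpose with hσ
  have hσs : σ.transpose = σ := by
    rw [hσ, Matrix.transpose_mul, Matrix.transpose_mul, Matrix.transpose_transpose, hτ,
      Matrix.mul_assoc]
  have hmax' : ∀ V ∈ Matrix.unitaryGroup n ℂ, ((V * σ * V.transpose).trace).re ≤ σ.trace.re := by
    intro V hV
    have : ((V * U * τ * (V * U).transpose).trace).re ≤ σ.trace.re := hmax (mul_mem hV hU)
    simpa only [hσ, Matrix.mul_assoc, Matrix.transpose_mul] using this
  obtain ⟨O, hO, hO', b, hb⟩ := exists_orthogonal_diagonal (σ.map Complex.im) (by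
    ext i j; exact congrArg Complex.im (congrFun (congrFun hσs i) j))
  have hOu := map_ofReal_mem_unitaryGroup hO
  set OC := O.map Complex.ofReal
  have him : ∀ i j, ((OC * σ * OC.transpose) i j).im = Matrix.diagonal b i j := by
    intro i j
    rw [← hb]
    simp [Matrix.mul_apply, OC, Finset.sum_mul]
  have htr : (OC * σ * OC.transpose).trace = σ.trace := by
    rw [Matrix.trace_mul_comm, ← Matrix.mul_assoc]
    have : OC.transpose * OC = 1 := by
      have h := congrArg (fun M => M.map (Complex.ofRealHom)) hO'
      simp only [Matrix.map_mul] at h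
      refine Eq.trans ?_ (h.trans ?_)
      · rfl
      · ext i j; by_cases hij : i = j <;> simp [Matrix.one_apply, hij]
    rw [this, Matrix.one_mul]
  have hb0 : ∀ i, b i = 0 := by
    choose z hz hzw using fun i => exists_unit_sq_mul_eq_norm ((OC * σ * OC.transpose) i i)
    have h := hmax' (Matrix.diagonal z * OC) (mul_mem (diagonal_mem_unitaryGroup hz) hOu)
    have e : (Matrix.diagonal z * OC * σ * (Matrix.diagonal z * OC).transpose) =
        Matrix.diagonal z * (OC * σ * OC.transpose) * Matrix.diagonal z := by
      simp [Matrix.transpose_mul, Matrix.mul_assoc]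
    rw [e, ← htr] at h
    simp only [Matrix.trace, Matrix.diag_apply, Matrix.mul_diagonal, Matrix.diagonal_mul, hzw,
      Complex.re_sum, Complex.ofReal_re] at h
    have h2 : ∀ i ∈ Finset.univ, ((OC * σ * OC.transpose) i i).re ≤ ‖(OC * σ * OC.transpose) i i‖ :=
      fun i _ => Complex.re_le_norm _
    have h3 := (Finset.sum_eq_sum_iff_of_le h2).mp (le_antisymm (Finset.sum_le_sum h2) h)
    intro i
    have h4 := h3 i (Finset.mem_univ i)
    have h5 := him i i
    rw [Matrix.diagonal_apply_eq] at h5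
    rw [← h5]
    have h6 := Complex.sq_norm ((OC * σ * OC.transpose) i i)
    rw [← h4, Complex.normSq_apply] at h6
    nlinarith
  have hreal : σ = (σ.map Complex.re).map Complex.ofReal := by
    have h0 : σ.map Complex.im = 0 := by
      have : Matrix.diagonal b = 0 := by
        ext i j; by_cases hij : i = j <;> simp [hij, hb0]
      rw [this] at hb
      calc σ.map Complex.im = (O.transpose * O) * σ.map Complex.im * (O.transpose * O) := by
            rw [hO']; simp
        _ = O.transpose * (O * σ.map Complex.im * O.transpose) * O := by
            simp only [Matrix.mul_assoc]
        _ = 0 := by rw [hb]; simp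
    ext i j
    apply Complex.ext
    · simp
    · simpa using congrFun (congrFun h0 i) j
  obtain ⟨Q, hQ, hQ', a, ha⟩ := exists_orthogonal_diagonal (σ.map Complex.re) (by
    ext i j; exact congrArg Complex.re (congrFun (congrFun hσs i) j))
  have hQu := map_ofReal_mem_unitaryGroup hQ
  have hQd : Q.map Complex.ofReal * σ * (Q.map Complex.ofReal).transpose =
      Matrix.diagonal (fun i => (a i : ℂ)) := by
    have h := congrArg (fun M => M.map (Complex.ofRealHom)) ha
    simp only [Matrix.map_mul] at h
    rw [hreal]
    refine Eq.trans ?_ (h.trans ?_)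
    · rfl
    · ext i j; by_cases hij : i = j <;> simp [hij]
  choose z hz hzw using fun i => exists_unit_sq_mul_eq_norm (a i : ℂ)
  refine ⟨Matrix.diagonal z * (Q.map Complex.ofReal * U),
    mul_mem (diagonal_mem_unitaryGroup hz) (mul_mem hQu hU), fun i => ‖(a i : ℂ)‖,
    fun i => norm_nonneg _, ?_⟩
  have e : Matrix.diagonal z * (Q.map Complex.ofReal * U) * τ *
      (Matrix.diagonal z * (Q.map Complex.ofReal * U)).transpose =
      Matrix.diagonal z * (Q.map Complex.ofReal * σ * (Q.map Complex.ofReal).transpose) *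
        Matrix.diagonal z := by
    simp [Matrix.transpose_mul, Matrix.mul_assoc, hσ]
  rw [e, hQd, Matrix.diagonal_mul_diagonal, Matrix.diagonal_mul_diagonal]
  congr 1; ext i; exact hzw i

/-- The polarization of the determinant on `2 × 2` matrices. -/
def detPol (X Y : Matrix (Fin 2) (Fin 2) ℂ) : ℂ :=
  X 0 0 * Y 1 1 + X 1 1 * Y 0 0 - X 0 1 * Y 1 0 - X 1 0 * Y 0 1

/-- The coefficient matrix of a two-qubit vector. -/
def coeffMat (w : Fin 2 × Fin 2 → ℂ) : Matrix (Fin 2) (Fin 2) ℂ :=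
  Matrix.of fun a b => w (a, b)

theorem detPol_self (X : Matrix (Fin 2) (Fin 2) ℂ) : detPol X X = 2 * X.det := by
  rw [Matrix.det_fin_two, detPol]; ring

theorem detPol_comm (X Y : Matrix (Fin 2) (Fin 2) ℂ) : detPol X Y = detPol Y X := by
  rw [detPol, detPol]; ring

/-- The vectors obtained from the family `w` by mixing with the matrix `U`. -/
def mix {ι κ d : Type*} [Fintype κ] (U : Matrix ι κ ℂ) (w : κ → d → ℂ) : ι → d → ℂ :=
  fun j x => ∑ k, U j k * w k x

theorem sum_pureDM_mix {κ d : Type*} [Fintype κ] [DecidableEq κ] {U : Matrix κ κ ℂ}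
    (hU : U ∈ Matrix.unitaryGroup κ ℂ) (w : κ → d → ℂ) :
    ∑ j, pureDM (mix U w j) = ∑ k, pureDM (w k) := by
  have h := Matrix.mem_unitaryGroup_iff'.mp hU
  have h' : ∀ k l, ∑ j, U j k * (starRingEnd ℂ) (U j l) = if k = l then 1 else 0 := by
    intro k l
    have := congrFun (congrFun h l) k
    rw [Matrix.mul_apply, Matrix.one_apply] at this
    simp only [Matrix.star_apply] at this
    rw [← (by simp [eq_comm] : (if l = k then (1 : ℂ) else 0) = if k = l then 1 else 0), ← this]
    exact Finset.sum_congr rfl fun j _ => mul_comm _ _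
  ext x y
  simp only [Matrix.sum_apply, pureDM, mix, map_sum, map_mul, Finset.sum_mul_sum]
  rw [Finset.sum_comm]
  refine Finset.sum_congr rfl fun k _ => ?_
  rw [Finset.sum_comm]
  have : ∀ l, ∑ j, U j k * w k x * ((starRingEnd ℂ) (U j l) * (starRingEnd ℂ) (w l y)) =
      (if k = l then 1 else 0) * (w k x * (starRingEnd ℂ) (w l y)) := by
    intro l
    rw [← h', Finset.sum_mul]
    exact Finset.sum_congr rfl fun j _ => by ring
  simp [this]

theorem detPol_mix_left {ι κ : Type*} [Fintype κ] (U : Matrix ι κ ℂ)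
    (w : κ → Fin 2 × Fin 2 → ℂ) (i : ι) (Y : Matrix (Fin 2) (Fin 2) ℂ) :
    detPol (coeffMat (mix U w i)) Y = ∑ k, U i k * detPol (coeffMat (w k)) Y := by
  simp only [detPol, coeffMat, mix, Matrix.of_apply, Finset.sum_mul, ← Finset.sum_add_distrib,
    ← Finset.sum_sub_distrib]
  exact Finset.sum_congr rfl fun k _ => by ring

theorem detPol_mix {ι κ : Type*} [Fintype κ] (U : Matrix ι κ ℂ) (w : κ → Fin 2 × Fin 2 → ℂ)
    (i j : ι) :
    detPol (coeffMat (mix U w i)) (coeffMat (mix U w j)) =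
      (U * Matrix.of (fun k l => detPol (coeffMat (w k)) (coeffMat (w l))) * U.transpose) i j := by
  rw [detPol_comm, detPol_mix_left, Matrix.mul_apply]
  refine Finset.sum_congr rfl fun l _ => ?_
  rw [detPol_comm, detPol_mix_left, Matrix.mul_apply, Matrix.transpose_apply, mul_comm]
  rfl

theorem sq_sub_trSq_pureDM (w : Fin 2 × Fin 2 → ℂ) :
    (∑ x, ‖w x‖ ^ 2) ^ 2 - trSq (ptraceRight (pureDM w)) = 2 * ‖(coeffMat w).det‖ ^ 2 := by
  simp only [trSq, ptraceRight, pureDM, Matrix.trace, Matrix.diag_apply, Matrix.mul_apply,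
    Matrix.det_fin_two, coeffMat, Matrix.of_apply, Fintype.sum_prod_type, Fin.sum_univ_two,
    Complex.sq_norm, Complex.normSq_apply, Complex.add_re, Complex.mul_re, Complex.sub_re,
    Complex.sub_im, Complex.add_im, Complex.mul_im, Complex.conj_re, Complex.conj_im]
  ring

theorem two_mul_norm_det_le (w : Fin 2 × Fin 2 → ℂ) :
    2 * ‖(coeffMat w).det‖ ≤ ∑ x, ‖w x‖ ^ 2 := by
  have h : ‖(coeffMat w).det‖ ≤ ‖w (0, 0)‖ * ‖w (1, 1)‖ + ‖w (0, 1)‖ * ‖w (1, 0)‖ := by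
    rw [Matrix.det_fin_two, ← norm_mul, ← norm_mul]
    exact norm_sub_le _ _
  simp only [Fintype.sum_prod_type, Fin.sum_univ_two]
  nlinarith [sq_nonneg (‖w (0, 0)‖ - ‖w (1, 1)‖), sq_nonneg (‖w (0, 1)‖ - ‖w (1, 0)‖)]

theorem pureConc_eq_s8 {w : Fin 2 × Fin 2 → ℂ} (hw : ∑ x, ‖w x‖ ^ 2 = 1) :
    pureConc w = 2 * ‖(coeffMat w).det‖ := by
  have h := sq_sub_trSq_pureDM w
  rw [hw, one_pow] at h
  rw [pureConc, h, show 2 * (2 * ‖(coeffMat w).det‖ ^ 2) = (2 * ‖(coeffMat w).det‖) ^ 2 by ring,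
    Real.sqrt_sq (by positivity)]

theorem mem_concSet {ι : Type*} [Fintype ι] {w : ι → Fin 2 × Fin 2 → ℂ}
    {ρ : Matrix (Fin 2 × Fin 2) (Fin 2 × Fin 2) ℂ} (hρ : ρ = ∑ k, pureDM (w k))
    (h1 : ∑ k, ∑ x, ‖w k x‖ ^ 2 = 1) :
    ∑ k, 2 * ‖(coeffMat (w k)).det‖ ∈ concSet ρ := by
  set p : ι → ℝ := fun k => ∑ x, ‖w k x‖ ^ 2 with hp
  have hp0 : ∀ k, 0 ≤ p k := fun k => Finset.sum_nonneg fun x _ => by positivity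
  let φ : ι → Fin 2 × Fin 2 → ℂ := fun k =>
    if p k = 0 then Pi.single (0, 0) 1 else fun x => ((√(p k))⁻¹ : ℝ) * w k x
  have hz : ∀ k, p k = 0 → w k = 0 := by
    intro k hk
    ext x
    have := (Finset.sum_eq_zero_iff_of_nonneg (fun x _ => by positivity)).mp hk x (Finset.mem_univ x)
    simpa using this
  have hφ : ∀ k, ∑ x, ‖φ k x‖ ^ 2 = 1 := by
    intro k
    by_cases hk : p k = 0
    · simp [φ, hk, Fintype.sum_prod_type, Pi.single_apply]
    · have hs : √(p k) ^ 2 = p k := Real.sq_sqrt (hp0 k)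
      simp only [φ, hk, if_false, norm_mul, mul_pow, ← Finset.mul_sum, Complex.norm_real,
        Real.norm_eq_abs, sq_abs, inv_pow, hs]
      exact inv_mul_cancel₀ hk
  have hd : ∀ k, p k * (2 * ‖(coeffMat (φ k)).det‖) = 2 * ‖(coeffMat (w k)).det‖ := by
    intro k
    by_cases hk : p k = 0
    · simp [hk, hz k hk, coeffMat, Matrix.det_fin_two]
    · have hs : √(p k) ^ 2 = p k := Real.sq_sqrt (hp0 k)
      have : (coeffMat (φ k)).det = (((p k)⁻¹ : ℝ) : ℂ) * (coeffMat (w k)).det := by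
        rw [← hs, ← inv_pow]
        simp only [φ, hk, if_false, coeffMat, Matrix.det_fin_two, Matrix.of_apply]
        push_cast
        ring
      rw [this, norm_mul, Complex.norm_real, Real.norm_eq_abs, abs_inv, abs_of_nonneg (hp0 k)]
      field_simp
  have hm : ∀ k, (p k : ℂ) • pureDM (φ k) = pureDM (w k) := by
    intro k
    by_cases hk : p k = 0
    · ext x y; simp [hk, hz k hk, pureDM]
    · have hs : √(p k) ^ 2 = p k := Real.sq_sqrt (hp0 k)
      have hs0 : √(p k) ≠ 0 := fun h => hk (by rw [← hs, h]; simp)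
      ext x y
      simp only [φ, hk, if_false, pureDM, Matrix.smul_apply, smul_eq_mul, map_mul,
        Complex.conj_ofReal]
      rw [← hs]
      have : (√(p k) : ℂ) ≠ 0 := by exact_mod_cast hs0
      push_cast
      simp only [Real.sqrt_sq (Real.sqrt_nonneg (p k))]
      field_simp
  let e := Fintype.equivFin ι
  refine ⟨Fintype.card ι, fun i => p (e.symm i), fun i => φ (e.symm i), fun i => hp0 _, ?_,
    fun i => hφ _, ?_, ?_⟩
  · rw [e.symm.sum_comp p]; exact h1
  · rw [e.symm.sum_comp (fun k => (p k : ℂ) • pureDM (φ k)), hρ]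
    exact Finset.sum_congr rfl fun k _ => (hm k).symm
  · rw [e.symm.sum_comp (fun k => p k * pureConc (φ k))]
    exact Finset.sum_congr rfl fun k _ => by rw [pureConc_eq_s8 (hφ k), hd]

theorem conc_nonneg {S T : Type*} [Fintype S] [Fintype T] (ρ : Matrix (S × T) (S × T) ℂ) :
    0 ≤ conc ρ := by
  refine Real.sInf_nonneg ?_
  rintro c ⟨n, p, φ, hp, -, -, -, rfl⟩
  exact Finset.sum_nonneg fun i _ => mul_nonneg (hp i) (Real.sqrt_nonneg _)

theorem conc_le_of_mem {S T : Type*} [Fintype S] [Fintype T] {ρ : Matrix (S × T) (S × T) ℂ}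
    {c : ℝ} (h : c ∈ concSet ρ) : conc ρ ≤ c := by
  refine csInf_le ⟨0, ?_⟩ h
  rintro c ⟨n, p, φ, hp, -, -, -, rfl⟩
  exact Finset.sum_nonneg fun i _ => mul_nonneg (hp i) (Real.sqrt_nonneg _)

theorem le_concA_of_mem {ρ : Matrix (Fin 2 × Fin 2) (Fin 2 × Fin 2) ℂ}
    {c : ℝ} (h : c ∈ concSet ρ) : c ≤ concA ρ := by
  refine le_csSup ⟨1, ?_⟩ h
  rintro c ⟨n, p, φ, hp, h1, hφ, -, rfl⟩
  rw [← h1]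
  refine Finset.sum_le_sum fun i _ => mul_le_of_le_one_right (hp i) ?_
  rw [pureConc_eq_s8 (hφ i), ← hφ i]
  exact two_mul_norm_det_le _

theorem sum_norm_sq_eq_re_trace {m n : Type*} [Fintype m] [Fintype n] (A : Matrix m n ℂ) :
    ∑ i, ∑ j, ‖A i j‖ ^ 2 = ((A * A.conjTranspose).trace).re := by
  simp [Matrix.trace, Matrix.mul_apply, Complex.sq_norm, Complex.normSq_apply, Complex.mul_re]

theorem sum_norm_sq_unitary_congr {n : Type*} [Fintype n] [DecidableEq n] {U : Matrix n n ℂ}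
    (hU : U ∈ Matrix.unitaryGroup n ℂ) (A : Matrix n n ℂ) :
    ∑ i, ∑ j, ‖(U * A * U.transpose) i j‖ ^ 2 = ∑ i, ∑ j, ‖A i j‖ ^ 2 := by
  have h1 : U.conjTranspose * U = 1 := Matrix.mem_unitaryGroup_iff'.mp hU
  have h2 : U.transpose * U.transpose.conjTranspose = 1 := by
    have := congrArg Matrix.transpose h1
    rw [Matrix.transpose_mul, Matrix.transpose_one] at this
    exact this
  rw [sum_norm_sq_eq_re_trace, sum_norm_sq_eq_re_trace, Matrix.conjTranspose_mul,
    Matrix.conjTranspose_mul]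
  have : U * A * U.transpose * (U.transpose.conjTranspose * (A.conjTranspose * U.conjTranspose)) =
      U * (A * A.conjTranspose * U.conjTranspose) := by
    calc _ = U * A * (U.transpose * U.transpose.conjTranspose) * (A.conjTranspose * U.conjTranspose) := by
          simp only [Matrix.mul_assoc]
      _ = _ := by rw [h2]; simp only [Matrix.mul_assoc, Matrix.one_mul]
  rw [this, Matrix.trace_mul_comm, Matrix.mul_assoc, h1, Matrix.mul_one]

theorem trace_pureDM {d : Type*} [Fintype d] (w : d → ℂ) :
    (pureDM w).trace = ((∑ x, ‖w x‖ ^ 2 : ℝ) : ℂ) := by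
  simp [Matrix.trace, pureDM, Complex.mul_conj, Complex.normSq_eq_norm_sq]

theorem sum_sum_norm_sq_mix {κ d : Type*} [Fintype κ] [DecidableEq κ] [Fintype d]
    {U : Matrix κ κ ℂ} (hU : U ∈ Matrix.unitaryGroup κ ℂ) (w : κ → d → ℂ) :
    ∑ k, ∑ x, ‖mix U w k x‖ ^ 2 = ∑ k, ∑ x, ‖w k x‖ ^ 2 := by
  have := congrArg Matrix.trace (sum_pureDM_mix hU w)
  simp only [Matrix.trace_sum, trace_pureDM] at this
  exact_mod_cast this

theorem sum_detPol_le_concA_sq {ι : Type*} [Fintype ι] {w : ι → Fin 2 × Fin 2 → ℂ}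
    {ρ : Matrix (Fin 2 × Fin 2) (Fin 2 × Fin 2) ℂ} (hρ : ρ = ∑ k, pureDM (w k))
    (h1 : ∑ k, ∑ x, ‖w k x‖ ^ 2 = 1) :
    ∑ k, ∑ l, ‖detPol (coeffMat (w k)) (coeffMat (w l))‖ ^ 2 ≤ concA ρ ^ 2 := by
  classical
  obtain ⟨U, hU, d, hd, hτ⟩ := takagi
    (Matrix.of fun k l => detPol (coeffMat (w k)) (coeffMat (w l)))
    (by ext i j; exact detPol_comm _ _)
  have hmem := mem_concSet (hρ.trans (sum_pureDM_mix hU w).symm)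
    ((sum_sum_norm_sq_mix hU w).trans h1)
  have hdet : ∀ k, 2 * ‖(coeffMat (mix U w k)).det‖ = d k := by
    intro k
    have := detPol_mix U w k k
    rw [hτ, detPol_self, Matrix.diagonal_apply_eq] at this
    rw [show 2 * ‖(coeffMat (mix U w k)).det‖ = ‖2 * (coeffMat (mix U w k)).det‖ by simp, this,
      Complex.norm_real, Real.norm_of_nonneg (hd k)]
  simp only [hdet] at hmem
  have hle := le_concA_of_mem hmem
  have h2 := sum_norm_sq_unitary_congr hU
    (Matrix.of fun k l => detPol (coeffMat (w k)) (coeffMat (w l)))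
  rw [hτ] at h2
  simp only [Matrix.of_apply] at h2
  rw [← h2]
  have h3 : ∀ i, ∑ j, ‖Matrix.diagonal (fun i => (d i : ℂ)) i j‖ ^ 2 = d i ^ 2 := by
    intro i
    rw [Finset.sum_eq_single i]
    · simp
    · intro j _ hj; simp [Matrix.diagonal_apply_ne _ hj.symm]
    · simp
  simp only [h3]
  calc ∑ i, d i ^ 2 ≤ (∑ i, d i) ^ 2 := Finset.sum_sq_le_sq_sum_of_nonneg (fun i _ => hd i)
    _ ≤ _ := pow_le_pow_left₀ (Finset.sum_nonneg fun i _ => hd i) hle 2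

theorem mul_add_mul_comm_fin_two (A B : Matrix (Fin 2) (Fin 2) ℂ) :
    A * B + B * A = A.trace • B + B.trace • A - detPol A B • (1 : Matrix (Fin 2) (Fin 2) ℂ) := by
  ext i j
  fin_cases i <;> fin_cases j <;>
    simp [Matrix.mul_apply, Fin.sum_univ_two, Matrix.trace, detPol] <;> ring

theorem detPol_mul_left (M A B : Matrix (Fin 2) (Fin 2) ℂ) :
    detPol (M * A) (M * B) = M.det * detPol A B := by
  simp only [detPol, Matrix.mul_apply, Fin.sum_univ_two, Matrix.det_fin_two]
  ring

theorem trace_adjugate_mul (X Y : Matrix (Fin 2) (Fin 2) ℂ) :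
    (X.adjugate * Y).trace = detPol X Y := by
  simp only [Matrix.trace, Matrix.mul_apply, Fin.sum_univ_two, Matrix.adjugate_fin_two, detPol,
    Matrix.diag_apply, Matrix.of_apply, Matrix.cons_val_zero, Matrix.cons_val_one]
  ring

theorem mul_self_eq_neg_one {A : Matrix (Fin 2) (Fin 2) ℂ} (ht : A.trace = 0) (hd : A.det = 1) :
    A * A = -1 := by
  have h := mul_add_mul_comm_fin_two A A
  rw [ht, detPol_self, hd, zero_smul, zero_add, zero_sub, ← two_smul ℂ, ← neg_smul] at h
  have := congrArg ((2 : ℂ)⁻¹ • ·) h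
  simpa [smul_smul] using this

theorem mul_comm_eq_neg {A B : Matrix (Fin 2) (Fin 2) ℂ} (hA : A.trace = 0) (hB : B.trace = 0)
    (h : detPol A B = 0) : B * A = -(A * B) := by
  have := mul_add_mul_comm_fin_two A B
  rw [hA, hB, h, zero_smul, zero_smul, zero_smul, add_zero, sub_zero] at this
  exact eq_neg_of_add_eq_zero_right this

/-- A `2 × 2` matrix commuting with a traceless one of unit determinant is, up to a scalar matrix,
a multiple of it. -/
theorem exists_smul_of_commute {A Z : Matrix (Fin 2) (Fin 2) ℂ} (hA : A.trace = 0)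
    (hd : A.det = 1) (hZ : Z.trace = 0) (hc : A * Z = Z * A) : ∃ γ : ℂ, Z = γ • A := by
  refine ⟨detPol A Z / 2, ?_⟩
  have h := mul_add_mul_comm_fin_two A Z
  rw [hA, hZ, ← hc, zero_smul, zero_smul, zero_add, zero_sub, ← two_smul ℂ] at h
  have h2 : A * ((2 : ℂ) • (A * Z)) = -((2 : ℂ) • Z) := by
    rw [Matrix.mul_smul, ← Matrix.mul_assoc, mul_self_eq_neg_one hA hd, neg_one_mul, smul_neg]
  rw [h, Matrix.mul_neg, Matrix.mul_smul, Matrix.mul_one, neg_inj] at h2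
  rw [div_eq_inv_mul, mul_smul, h2, smul_smul]
  simp

/-- Three pairwise anticommuting square roots of `-1` in `2 × 2` matrices multiply to a scalar. -/
theorem exists_smul_mul_of_anticomm {A B C : Matrix (Fin 2) (Fin 2) ℂ}
    (hA : A.trace = 0) (hB : B.trace = 0) (hC : C.trace = 0)
    (dA : A.det = 1) (dB : B.det = 1) (dC : C.det = 1)
    (hAB : detPol A B = 0) (hAC : detPol A C = 0) (hBC : detPol B C = 0) :
    ∃ z : ℂ, ‖z‖ = 1 ∧ C = z • (A * B) := by
  have aa := mul_self_eq_neg_one hA dA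
  have bb := mul_self_eq_neg_one hB dB
  have ba := mul_comm_eq_neg hA hB hAB
  have ca := mul_comm_eq_neg hA hC hAC
  have cb := mul_comm_eq_neg hB hC hBC
  set Z := C * A * B with hZ
  have zA : A * Z = Z * A := by
    have h1 : A * Z = C * B := by
      rw [hZ, ca]; simp only [Matrix.neg_mul, Matrix.mul_neg]
      rw [← Matrix.mul_assoc, ← Matrix.mul_assoc, aa]
      rw [cb]; simp [cb]
    have h2 : Z * A = C * B := by
      rw [hZ, Matrix.mul_assoc, ba, Matrix.mul_assoc, Matrix.mul_neg, ← Matrix.mul_assoc A, aa]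
      simp
    rw [h1, h2]
  have zB : B * Z = Z * B := by
    have h2 : Z * B = -(C * A) := by rw [hZ, Matrix.mul_assoc, bb]; simp
    have h1 : B * Z = -(C * A) := by
      have : B * C = -(C * B) := by rw [cb, neg_neg]
      rw [hZ, ← Matrix.mul_assoc, ← Matrix.mul_assoc, this, Matrix.neg_mul, Matrix.mul_assoc C, ba]
      simp only [Matrix.mul_neg, neg_neg]
      rw [Matrix.mul_assoc, Matrix.mul_assoc, bb]; simp
    rw [h1, h2]
  set Z₀ := Z - (Z.trace / 2) • (1 : Matrix (Fin 2) (Fin 2) ℂ) with hZ0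
  have t0 : Z₀.trace = 0 := by
    rw [hZ0, Matrix.trace_sub, Matrix.trace_smul, Matrix.trace_one]; simp
  obtain ⟨γ, hγ⟩ := exists_smul_of_commute hA dA t0 (by rw [hZ0]; simp [Matrix.mul_sub, Matrix.sub_mul, zA])
  obtain ⟨δ, hδ⟩ := exists_smul_of_commute hB dB t0 (by rw [hZ0]; simp [Matrix.mul_sub, Matrix.sub_mul, zB])
  have hz : Z₀ = 0 := by
    have e1 : Z₀ * Z₀ = (γ * δ) • (A * B) := by
      nth_rewrite 1 [hγ]; rw [hδ]; simp [smul_smul, mul_comm]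
    have e2 : Z₀ * Z₀ = -((γ * δ) • (A * B)) := by
      nth_rewrite 1 [hδ]; rw [hγ, Matrix.smul_mul, Matrix.mul_smul, ba, smul_smul, smul_neg, mul_comm]
    have e3 : Z₀ * Z₀ = 0 := by
      ext i j
      exact self_eq_neg.mp ((congrFun (congrFun (e2.trans (congrArg _ e1.symm)) i) j))
    have e4 : γ * γ = 0 := by
      have : Z₀ * Z₀ = -((γ * γ) • (1 : Matrix (Fin 2) (Fin 2) ℂ)) := by
        nth_rewrite 1 [hγ]; rw [hγ, Matrix.smul_mul, Matrix.mul_smul, aa, smul_smul, smul_neg]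
      rw [e3] at this
      have := congrFun (congrFun this 0) 0
      simpa using this
    rw [hγ, mul_self_eq_zero.mp e4, zero_smul]
  have hs : Z = (Z.trace / 2) • (1 : Matrix (Fin 2) (Fin 2) ℂ) := sub_eq_zero.mp hz
  set z := Z.trace / 2
  have abab : A * B * (A * B) = -1 := by
    rw [Matrix.mul_assoc, ← Matrix.mul_assoc B, ba, Matrix.neg_mul, Matrix.mul_neg, Matrix.mul_assoc,
      bb, ← Matrix.mul_assoc, aa]
    simp
  have hCz : C = (-z) • (A * B) := by
    have : C * (A * B) = z • 1 := by rw [← Matrix.mul_assoc]; exact hs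
    have h := congrArg (· * (A * B)) this
    simp only [Matrix.mul_assoc C, abab, Matrix.mul_neg, Matrix.mul_one, Matrix.smul_mul,
      Matrix.one_mul] at h
    rw [neg_smul, ← h, neg_neg]
  refine ⟨-z, ?_, hCz⟩
  have hdz : (-z) ^ 2 = 1 := by
    have := congrArg Matrix.det hCz
    rw [dC, Matrix.det_smul, Matrix.det_mul, dA, dB] at this
    simpa using this.symm
  have := congrArg norm hdz
  rw [norm_pow, norm_one] at this
  exact (pow_eq_one_iff_of_nonneg (norm_nonneg _) two_ne_zero).mp this

open scoped ComplexOrder in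
theorem exists_hermitian_conj {A B C : Matrix (Fin 2) (Fin 2) ℂ}
    (hA : A.trace = 0) (hB : B.trace = 0) (hC : C.trace = 0)
    (dA : A.det = 1) (dB : B.det = 1) (dC : C.det = 1)
    (hAB : detPol A B = 0) (hAC : detPol A C = 0) (hBC : detPol B C = 0) :
    ∃ N : Matrix (Fin 2) (Fin 2) ℂ, N.IsHermitian ∧ N.det.re < 0 ∧
      A * N * A.conjTranspose = N ∧ B * N * B.conjTranspose = -N ∧
      C * N * C.conjTranspose = -N := by
  obtain ⟨z, hz, hCz⟩ := exists_smul_mul_of_anticomm hA hB hC dA dB dC hAB hAC hBC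
  have aa := mul_self_eq_neg_one hA dA
  have bb := mul_self_eq_neg_one hB dB
  have ba := mul_comm_eq_neg hA hB hAB
  set P : Matrix (Fin 2) (Fin 2) ℂ := 1 + (A * A.conjTranspose + B * B.conjTranspose +
    (A * B) * (A * B).conjTranspose) with hP
  have Ppos : P.PosDef := Matrix.PosDef.one.add_posSemidef
    (((Matrix.posSemidef_self_mul_conjTranspose A).add
      (Matrix.posSemidef_self_mul_conjTranspose B)).add
      (Matrix.posSemidef_self_mul_conjTranspose (A * B)))
  have conj : ∀ X Y : Matrix (Fin 2) (Fin 2) ℂ,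
      X * (Y * Y.conjTranspose) * X.conjTranspose = (X * Y) * (X * Y).conjTranspose := by
    intro X Y; rw [Matrix.conjTranspose_mul]; simp only [Matrix.mul_assoc]
  have bab : B * (A * B) = A := by
    rw [← Matrix.mul_assoc, ba, Matrix.neg_mul, Matrix.mul_assoc, bb]; simp
  have aab : A * (A * B) = -B := by rw [← Matrix.mul_assoc, aa]; simp
  have hPA : A * P * A.conjTranspose = P := by
    rw [hP]
    simp only [Matrix.mul_add, Matrix.add_mul, conj, aa, aab, Matrix.mul_one]
    simp only [Matrix.conjTranspose_neg, Matrix.conjTranspose_one, Matrix.neg_mul, Matrix.mul_neg,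
      neg_neg, Matrix.mul_one]
    abel
  have hPB : B * P * B.conjTranspose = P := by
    rw [hP]
    simp only [Matrix.mul_add, Matrix.add_mul, conj, bb, bab, ba, Matrix.mul_one]
    simp only [Matrix.conjTranspose_neg, Matrix.conjTranspose_one, Matrix.neg_mul, Matrix.mul_neg,
      neg_neg, Matrix.mul_one]
    abel
  have hherm : A * P = -(P * A.conjTranspose) := by
    have := congrArg (A * ·) hPA
    simp only [← Matrix.mul_assoc, aa] at this
    rw [← this]; simp
  set N : Matrix (Fin 2) (Fin 2) ℂ := Complex.I • (A * P) with hN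
  have hNA : A * N * A.conjTranspose = N := by
    rw [hN, Matrix.mul_smul, Matrix.smul_mul, Matrix.mul_assoc A (A * P), Matrix.mul_assoc A P,
      ← Matrix.mul_assoc A P, hPA]
  have hNB : B * N * B.conjTranspose = -N := by
    rw [hN, Matrix.mul_smul, Matrix.smul_mul, ← Matrix.mul_assoc, ba, Matrix.neg_mul, Matrix.neg_mul,
      Matrix.mul_assoc A, Matrix.mul_assoc A, hPB, smul_neg]
  refine ⟨N, ?_, ?_, hNA, hNB, ?_⟩
  · rw [Matrix.IsHermitian, hN, Matrix.conjTranspose_smul, Matrix.conjTranspose_mul,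
      Ppos.isHermitian.eq, hherm]
    simp
  · have := Ppos.det_pos
    rw [hN, Matrix.det_smul, Matrix.det_mul, dA]
    simpa using (Complex.pos_iff.mp this).1
  · have hzz : z * star z = 1 := by
      rw [Complex.star_def, Complex.mul_conj, Complex.normSq_eq_norm_sq, hz]; simp
    rw [hCz, Matrix.conjTranspose_smul, Matrix.smul_mul, Matrix.mul_smul, Matrix.smul_mul,
      smul_smul, mul_comm, hzz, one_smul, Matrix.conjTranspose_mul]
    calc A * B * N * (B.conjTranspose * A.conjTranspose)
        = A * (B * N * B.conjTranspose) * A.conjTranspose := by simp only [Matrix.mul_assoc]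
      _ = -N := by rw [hNB, Matrix.mul_neg, Matrix.neg_mul, hNA]

/-- The unnormalized state of the first qubit of `ρ` conditioned on the second one being projected
onto the conjugate of the `k`-th row of `V`. -/
def condRed (V : Matrix (Fin 2) (Fin 2) ℂ) (ρ : Matrix (Fin 2 × Fin 2) (Fin 2 × Fin 2) ℂ)
    (k : Fin 2) : Matrix (Fin 2) (Fin 2) ℂ :=
  Matrix.of fun a a' => ∑ b, ∑ b', V k b * (starRingEnd ℂ) (V k b') * ρ (a, b) (a', b')

/-- The slack in the Minkowski-type determinant inequality for the two conditional states. -/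
def condGap (V : Matrix (Fin 2) (Fin 2) ℂ) (ρ : Matrix (Fin 2 × Fin 2) (Fin 2 × Fin 2) ℂ) : ℝ :=
  (detPol (condRed V ρ 0) (condRed V ρ 1)).re -
    2 * √((condRed V ρ 0).det.re * (condRed V ρ 1).det.re)

theorem condRed_sum {ι : Type*} [Fintype ι] (V : Matrix (Fin 2) (Fin 2) ℂ)
    (ρ : ι → Matrix (Fin 2 × Fin 2) (Fin 2 × Fin 2) ℂ) (k : Fin 2) :
    condRed V (∑ j, ρ j) k = ∑ j, condRed V (ρ j) k := by
  ext a a'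
  simp only [condRed, Matrix.of_apply, Matrix.sum_apply, Finset.mul_sum]
  rw [Finset.sum_congr rfl fun b _ => Finset.sum_comm, Finset.sum_comm]

open scoped ComplexOrder in
theorem condRed_posSemidef {ι : Type*} [Fintype ι] (V : Matrix (Fin 2) (Fin 2) ℂ)
    (w : ι → Fin 2 × Fin 2 → ℂ) (k : Fin 2) :
    (condRed V (∑ j, pureDM (w j)) k).PosSemidef := by
  rw [condRed_sum]
  refine Matrix.posSemidef_sum _ fun j _ => ?_
  have : condRed V (pureDM (w j)) k =
      Matrix.vecMulVec (fun a => ∑ b, V k b * w j (a, b)) (star fun a => ∑ b, V k b * w j (a, b)) := by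
    ext a a'
    simp only [condRed, pureDM, Matrix.of_apply, Matrix.vecMulVec_apply, Pi.star_apply, star_sum,
      Finset.sum_mul_sum, star_mul', Complex.star_def]
    exact Finset.sum_congr rfl fun b _ => Finset.sum_congr rfl fun b' _ => by ring
  rw [this]
  exact Matrix.posSemidef_vecMulVec_self_star _

open scoped ComplexOrder in
theorem condRed_det_re_nonneg {ι : Type*} [Fintype ι] (V : Matrix (Fin 2) (Fin 2) ℂ)
    (w : ι → Fin 2 × Fin 2 → ℂ) (k : Fin 2) :
    0 ≤ (condRed V (∑ j, pureDM (w j)) k).det.re :=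
  (Complex.nonneg_iff.mp (condRed_posSemidef V w k).det_nonneg).1

theorem exists_spectral_fin_two {N : Matrix (Fin 2) (Fin 2) ℂ} (hN : N.IsHermitian) :
    ∃ V ∈ Matrix.unitaryGroup (Fin 2) ℂ, ∃ ν : Fin 2 → ℝ, N.det = ν 0 * ν 1 ∧
      ∀ b b', N b b' = ∑ k, ν k * (V k b * (starRingEnd ℂ) (V k b')) := by
  refine ⟨(hN.eigenvectorUnitary : Matrix (Fin 2) (Fin 2) ℂ).transpose, ?_, hN.eigenvalues, ?_, ?_⟩
  · rw [Matrix.mem_unitaryGroup_iff']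
    have h := congrArg Matrix.transpose (Matrix.mem_unitaryGroup_iff.mp hN.eigenvectorUnitary.2)
    rw [Matrix.transpose_mul, Matrix.transpose_one] at h
    exact h
  · rw [hN.det_eq_prod_eigenvalues]; simp [Fin.prod_univ_two]
  · intro b b'
    have h := congrFun (congrFun hN.spectral_theorem b) b'
    rw [Unitary.conjStarAlgAut_apply, Matrix.mul_apply] at h
    rw [h]
    refine Finset.sum_congr rfl fun k _ => ?_
    rw [Matrix.mul_diagonal, Matrix.star_apply]
    simp
    ring

theorem det_smul_add_smul (x y : ℂ) (A B : Matrix (Fin 2) (Fin 2) ℂ) :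
    (x • A + y • B).det = x ^ 2 * A.det + y ^ 2 * B.det + x * y * detPol A B := by
  simp only [Matrix.det_fin_two, detPol, Matrix.add_apply, Matrix.smul_apply, smul_eq_mul]
  ring

theorem exists_hermitian_conj_family {X : Fin 2 × Fin 2 → Matrix (Fin 2) (Fin 2) ℂ}
    (hd : ∀ j, (X j).det = 1) (hX : ∀ i j, i ≠ j → detPol (X i) (X j) = 0) :
    ∃ N M : Matrix (Fin 2) (Fin 2) ℂ, N.IsHermitian ∧ N.det.re < 0 ∧ M.det = N.det ∧
      ∀ j, X j * N * (X j).conjTranspose = (if j.1 = 0 then (1 : ℂ) else -1) • M := by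
  have h0 : X (0, 0) * (X (0, 0)).adjugate = 1 := by rw [Matrix.mul_adjugate, hd, one_smul]
  have hda : ((X (0, 0)).adjugate).det = 1 := by rw [Matrix.det_adjugate, hd, one_pow]
  have hD : ∀ j, ((X (0, 0)).adjugate * X j).det = 1 := fun j => by
    rw [Matrix.det_mul, hda, hd, one_mul]
  have hT : ∀ j, (0, 0) ≠ j → ((X (0, 0)).adjugate * X j).trace = 0 := fun j hj => by
    rw [trace_adjugate_mul, hX _ _ hj]
  have hP : ∀ i j, i ≠ j → detPol ((X (0, 0)).adjugate * X i) ((X (0, 0)).adjugate * X j) = 0 :=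
    fun i j hij => by rw [detPol_mul_left, hX _ _ hij, mul_zero]
  obtain ⟨N, hN, hneg, e1, e2, e3⟩ := exists_hermitian_conj (hT (0, 1) (by decide))
    (hT (1, 0) (by decide)) (hT (1, 1) (by decide)) (hD (0, 1)) (hD (1, 0)) (hD (1, 1))
    (hP _ _ (by decide)) (hP _ _ (by decide)) (hP _ _ (by decide))
  have key : ∀ j (z : ℂ), (X (0, 0)).adjugate * X j * N *
      ((X (0, 0)).adjugate * X j).conjTranspose = z • N →
      X j * N * (X j).conjTranspose = z • (X (0, 0) * N * (X (0, 0)).conjTranspose) := by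
    intro j z h
    have hj : X j = X (0, 0) * ((X (0, 0)).adjugate * X j) := by
      rw [← Matrix.mul_assoc, h0, Matrix.one_mul]
    have := congrArg (fun Y => X (0, 0) * Y * (X (0, 0)).conjTranspose) h
    rw [Matrix.mul_smul, Matrix.smul_mul] at this
    rw [← this]
    nth_rewrite 1 2 [hj]
    rw [Matrix.conjTranspose_mul (X (0, 0))]
    simp only [Matrix.mul_assoc]
  refine ⟨N, X (0, 0) * N * (X (0, 0)).conjTranspose, hN, hneg, ?_, ?_⟩
  · simp [Matrix.det_mul, Matrix.det_conjTranspose, hd]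
  · rintro ⟨a, b⟩
    fin_cases a <;> fin_cases b
    · simp
    · exact key _ _ (by simpa using e1)
    · exact key _ _ (by simpa using e2)
    · exact key _ _ (by simpa using e3)

theorem exists_sq_le_condGap {w : Fin 2 × Fin 2 → Fin 2 × Fin 2 → ℂ} {h : Fin 2 × Fin 2 → ℝ}
    (hpos : ∀ j, 0 < h j) (hdet : ∀ j, (coeffMat (w j)).det = h j)
    (hw : ∀ i j, i ≠ j → detPol (coeffMat (w i)) (coeffMat (w j)) = 0) :
    ∃ V ∈ Matrix.unitaryGroup (Fin 2) ℂ,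
      (h (0, 0) + h (0, 1) - h (1, 0) - h (1, 1)) ^ 2 ≤ condGap V (∑ j, pureDM (w j)) := by
  set X : Fin 2 × Fin 2 → Matrix (Fin 2) (Fin 2) ℂ :=
    fun j => ((√(h j))⁻¹ : ℂ) • coeffMat (w j) with hXdef
  have hs : ∀ j, ((√(h j) : ℝ) : ℂ) ^ 2 = h j := fun j => by
    rw [← Complex.ofReal_pow, Real.sq_sqrt (hpos j).le]
  have hs0 : ∀ j, ((√(h j) : ℝ) : ℂ) ≠ 0 := fun j => by
    exact_mod_cast (Real.sqrt_pos.mpr (hpos j)).ne'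
  obtain ⟨N, M, hN, hneg, hM, hX⟩ := exists_hermitian_conj_family (X := X)
    (fun j => by
      rw [hXdef, Matrix.det_smul, hdet, Fintype.card_fin, inv_pow, hs]
      exact inv_mul_cancel₀ (by exact_mod_cast (hpos j).ne'))
    (fun i j hij => by
      have := hw i j hij
      simp only [detPol, hXdef, Matrix.smul_apply, smul_eq_mul] at this ⊢
      linear_combination ((√(h i))⁻¹ : ℂ) * ((√(h j))⁻¹ : ℂ) * this)
  obtain ⟨V, hV, ν, hν, hNV⟩ := exists_spectral_fin_two hN
  refine ⟨V, hV, ?_⟩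
  set s : ℝ := h (0, 0) + h (0, 1) - h (1, 0) - h (1, 1) with hsdef
  set R := condRed V (∑ j, pureDM (w j)) with hR
  have hΦ : (ν 0 : ℂ) • R 0 + (ν 1 : ℂ) • R 1 = (s : ℂ) • M := by
    have e1 : ∀ j, coeffMat (w j) * N * (coeffMat (w j)).conjTranspose =
        (h j : ℂ) • (X j * N * (X j).conjTranspose) := by
      intro j
      have : coeffMat (w j) = ((√(h j) : ℝ) : ℂ) • X j := by
        rw [hXdef, smul_smul, mul_inv_cancel₀ (hs0 j), one_smul]
      rw [this, Matrix.conjTranspose_smul, Complex.star_def, Complex.conj_ofReal, Matrix.smul_mul,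
        Matrix.smul_mul, Matrix.mul_smul, smul_smul, ← sq, hs]
    have e2 : (ν 0 : ℂ) • R 0 + (ν 1 : ℂ) • R 1 =
        ∑ j, coeffMat (w j) * N * (coeffMat (w j)).conjTranspose := by
      rw [hR, condRed_sum, condRed_sum, Finset.smul_sum, Finset.smul_sum, ← Finset.sum_add_distrib]
      refine Finset.sum_congr rfl fun j _ => ?_
      ext a a'
      simp only [condRed, pureDM, coeffMat, Matrix.add_apply, Matrix.smul_apply, Matrix.of_apply,
        smul_eq_mul, Matrix.mul_apply, Matrix.conjTranspose_apply, Fin.sum_univ_two, hNV,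
        Complex.star_def]
      ring
    rw [e2, Finset.sum_congr rfl fun j _ => (e1 j).trans (congrArg _ (hX j)), Fintype.sum_prod_type]
    simp only [Fin.sum_univ_two, Fin.isValue, if_true, one_ne_zero, if_false, smul_smul, ← add_smul]
    congr 1
    rw [hsdef]; push_cast; ring
  have hdetΦ := congrArg Matrix.det hΦ
  rw [det_smul_add_smul, Matrix.det_smul, hM, hν, Fintype.card_fin] at hdetΦ
  have p0 := condRed_det_re_nonneg V w 0
  have p1 := condRed_det_re_nonneg V w 1
  rw [← hR] at p0 p1
  have hre := congrArg Complex.re hdetΦ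
  simp only [← Complex.ofReal_pow, ← Complex.ofReal_mul, Complex.add_re, Complex.re_ofReal_mul,
    Complex.ofReal_re] at hre
  have hνneg : ν 0 * ν 1 < 0 := by
    rw [hν, ← Complex.ofReal_mul, Complex.ofReal_re] at hneg; exact hneg
  rw [condGap, ← hR]
  have hsq : √((R 0).det.re * (R 1).det.re) ^ 2 = (R 0).det.re * (R 1).det.re :=
    Real.sq_sqrt (mul_nonneg p0 p1)
  set q := √((R 0).det.re * (R 1).det.re)
  have hq : 0 ≤ q := Real.sqrt_nonneg _
  have amgm : 2 * (-(ν 0 * ν 1)) * q ≤ ν 0 ^ 2 * (R 0).det.re + ν 1 ^ 2 * (R 1).det.re := by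
    refine abs_le_of_sq_le_sq' ?_ (by positivity) |>.2
    rw [mul_pow, hsq]
    nlinarith [sq_nonneg (ν 0 ^ 2 * (R 0).det.re - ν 1 ^ 2 * (R 1).det.re)]
  have : (-(ν 0 * ν 1)) * s ^ 2 ≤ (-(ν 0 * ν 1)) * ((detPol (R 0) (R 1)).re - 2 * q) := by
    nlinarith
  exact le_of_mul_le_mul_left this (by linarith)

/-- The signed sum of determinants produced by the Hadamard mixing. -/
def signedDet (W : Fin 2 × Fin 2 → Fin 2 × Fin 2 → ℂ) : ℂ :=
  (coeffMat (W (0, 0))).det + (coeffMat (W (0, 1))).det - (coeffMat (W (1, 0))).det -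
    (coeffMat (W (1, 1))).det

/-- The matrix of the bilinear form `detPol` on two-qubit vectors. -/
def detPolMat : Matrix (Fin 2 × Fin 2) (Fin 2 × Fin 2) ℂ :=
  Matrix.of fun x y => if x.1 = y.1 ∨ x.2 = y.2 then 0 else if x.1 = x.2 then 1 else -1

theorem detPolMat_mul_self : detPolMat * detPolMat = 1 := by
  ext ⟨a, b⟩ ⟨c, d⟩
  fin_cases a <;> fin_cases b <;> fin_cases c <;> fin_cases d <;>
    simp [detPolMat, Matrix.mul_apply, Fintype.sum_prod_type, Fin.sum_univ_two]

theorem of_detPol_eq (G : Fin 2 × Fin 2 → Fin 2 × Fin 2 → ℂ) :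
    Matrix.of (fun k l => detPol (coeffMat (G k)) (coeffMat (G l))) =
      Matrix.of G * detPolMat * (Matrix.of G).transpose := by
  ext k l
  simp only [Matrix.mul_apply, Fintype.sum_prod_type, Fin.sum_univ_two, detPolMat, Matrix.of_apply,
    detPol, coeffMat, Matrix.transpose_apply]
  simp
  ring

theorem exists_mix_of_det_ne_zero {G : Fin 2 × Fin 2 → Fin 2 × Fin 2 → ℂ}
    (hG : (Matrix.of G).det ≠ 0) :
    ∃ U ∈ Matrix.unitaryGroup (Fin 2 × Fin 2) ℂ, ∃ V ∈ Matrix.unitaryGroup (Fin 2) ℂ,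
      (∀ i j, i ≠ j → detPol (coeffMat (mix U G i)) (coeffMat (mix U G j)) = 0) ∧
      ‖signedDet (mix U G)‖ ^ 2 ≤ condGap V (∑ j, pureDM (G j)) := by
  obtain ⟨U, hU, d, hd, hτ⟩ := takagi
    (Matrix.of fun k l => detPol (coeffMat (G k)) (coeffMat (G l)))
    (by ext i j; exact detPol_comm _ _)
  have hmix : ∀ i j, detPol (coeffMat (mix U G i)) (coeffMat (mix U G j)) =
      Matrix.diagonal (fun i => (d i : ℂ)) i j := fun i j => by
    rw [← hτ, ← detPol_mix]
  have hoff : ∀ i j, i ≠ j → detPol (coeffMat (mix U G i)) (coeffMat (mix U G j)) = 0 :=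
    fun i j hij => by rw [hmix, Matrix.diagonal_apply_ne _ hij]
  have hdet : ∀ j, (coeffMat (mix U G j)).det = ((d j / 2 : ℝ) : ℂ) := fun j => by
    have := hmix j j
    rw [detPol_self, Matrix.diagonal_apply_eq] at this
    rw [Complex.ofReal_div, ← this]; simp
  have hUd : U.det ≠ 0 := by
    have := congrArg Matrix.det (Matrix.mem_unitaryGroup_iff.mp hU)
    rw [Matrix.det_mul, Matrix.det_one] at this
    exact left_ne_zero_of_mul_eq_one this
  have hJ : detPolMat.det ≠ 0 := by
    have := congrArg Matrix.det detPolMat_mul_self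
    rw [Matrix.det_mul, Matrix.det_one] at this
    exact left_ne_zero_of_mul_eq_one this
  have hpos : ∀ j, 0 < d j / 2 := fun j => by
    have h := congrArg Matrix.det hτ
    rw [of_detPol_eq, Matrix.det_diagonal] at h
    simp only [Matrix.det_mul, Matrix.det_transpose] at h
    have h0 : ∏ i, (d i : ℂ) ≠ 0 := by
      rw [← h]
      exact mul_ne_zero (mul_ne_zero hUd (mul_ne_zero (mul_ne_zero hG hJ) hG)) hUd
    have := Finset.prod_ne_zero_iff.mp h0 j (Finset.mem_univ j)
    exact half_pos (lt_of_le_of_ne (hd j) (Ne.symm (by exact_mod_cast this)))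
  obtain ⟨V, hV, hle⟩ := exists_sq_le_condGap hpos hdet hoff
  refine ⟨U, hU, V, hV, hoff, ?_⟩
  rw [sum_pureDM_mix hU] at hle
  refine le_trans (le_of_eq ?_) hle
  rw [signedDet, hdet, hdet, hdet, hdet]
  norm_cast
  rw [Real.norm_eq_abs, sq_abs]

theorem dense_det_ne_zero (κ : Type*) [Fintype κ] [DecidableEq κ] :
    Dense {G : Matrix κ κ ℂ | G.det ≠ 0} := by
  intro G
  have hfin : {t : ℂ | ((-G).charpoly).eval t = 0}.Finite := by
    refine ((-G).charpoly.roots.toFinset.finite_toSet).subset fun t ht => ?_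
    simp only [Finset.mem_coe, Multiset.mem_toFinset]
    exact (Polynomial.mem_roots ((-G).charpoly_monic.ne_zero)).mpr ht
  have hdense : Dense {t : ℂ | ((-G).charpoly).eval t = 0}ᶜ := hfin.countable.dense_compl ℂ
  have hcont : Continuous fun t : ℂ => Matrix.scalar κ t + G := by
    refine continuous_matrix fun i j => ?_
    simp only [Matrix.scalar_apply, Matrix.add_apply, Matrix.diagonal_apply]
    split_ifs <;> fun_prop
  have := map_mem_closure (t := {G : Matrix κ κ ℂ | G.det ≠ 0}) hcont (hdense 0) (fun t ht => by
    simpa [Matrix.eval_charpoly, sub_neg_eq_add] using ht)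
  simpa using this

theorem continuous_condGap {T : Type*} [TopologicalSpace T] {V : T → Matrix (Fin 2) (Fin 2) ℂ}
    {ρ : T → Matrix (Fin 2 × Fin 2) (Fin 2 × Fin 2) ℂ} (hV : Continuous V) (hρ : Continuous ρ) :
    Continuous fun p => condGap (V p) (ρ p) := by
  have h : ∀ k a a', Continuous fun p => condRed (V p) (ρ p) k a a' := by
    intro k a a'
    simp only [condRed, Matrix.of_apply]
    exact continuous_finsetSum _ fun b _ => continuous_finsetSum _ fun b' _ =>
      ((hV.matrix_elem k b).mul (Complex.continuous_conj.comp (hV.matrix_elem k b'))).mul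
        (hρ.matrix_elem _ _)
  simp only [condGap, detPol, Matrix.det_fin_two]
  fun_prop

theorem continuous_mix {T : Type*} [TopologicalSpace T] {κ d : Type*} [Fintype κ]
    {U : T → Matrix κ κ ℂ} {G : T → κ → d → ℂ} (hU : Continuous U) (hG : Continuous G) (i : κ)
    (x : d) : Continuous fun p => mix (U p) (G p) i x :=
  continuous_finsetSum _ fun k _ => (hU.matrix_elem i k).mul
    ((continuous_apply x).comp ((continuous_apply k).comp hG))

theorem continuous_detPol_coeffMat {T : Type*} [TopologicalSpace T]
    {v w : T → Fin 2 × Fin 2 → ℂ} (hv : ∀ x, Continuous fun p => v p x)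
    (hw : ∀ x, Continuous fun p => w p x) :
    Continuous fun p => detPol (coeffMat (v p)) (coeffMat (w p)) := by
  simp only [detPol, coeffMat, Matrix.of_apply]
  exact ((((hv _).mul (hw _)).add ((hv _).mul (hw _))).sub ((hv _).mul (hw _))).sub
    ((hv _).mul (hw _))

theorem continuous_signedDet {T : Type*} [TopologicalSpace T]
    {W : T → Fin 2 × Fin 2 → Fin 2 × Fin 2 → ℂ} (hW : ∀ i x, Continuous fun p => W p i x) :
    Continuous fun p => signedDet (W p) := by
  simp only [signedDet, coeffMat, Matrix.of_apply, Matrix.det_fin_two]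
  have h : ∀ i x y z t, Continuous fun p => W p i x * W p i y - W p i z * W p i t :=
    fun i x y z t => ((hW i x).mul (hW i y)).sub ((hW i z).mul (hW i t))
  exact (((h _ _ _ _ _).add (h _ _ _ _ _)).sub (h _ _ _ _ _)).sub (h _ _ _ _ _)

theorem continuous_sum_pureDM {T : Type*} [TopologicalSpace T] {ι d : Type*} [Fintype ι]
    {G : T → ι → d → ℂ} (hG : Continuous G) : Continuous fun p => ∑ j, pureDM (G p j) := by
  refine continuous_finsetSum _ fun j _ => continuous_matrix fun x y => ?_
  have h : ∀ x, Continuous fun p => G p j x := fun x =>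
    (continuous_apply x).comp ((continuous_apply j).comp hG)
  exact (h x).mul (Complex.continuous_conj.comp (h y))

theorem exists_mix (G : Fin 2 × Fin 2 → Fin 2 × Fin 2 → ℂ) :
    ∃ U ∈ Matrix.unitaryGroup (Fin 2 × Fin 2) ℂ, ∃ V ∈ Matrix.unitaryGroup (Fin 2) ℂ,
      (∀ i j, i ≠ j → detPol (coeffMat (mix U G i)) (coeffMat (mix U G j)) = 0) ∧
      ‖signedDet (mix U G)‖ ^ 2 ≤ condGap V (∑ j, pureDM (G j)) := by
  have hfst : Continuous fun p : (Fin 2 × Fin 2 → Fin 2 × Fin 2 → ℂ) ×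
    (Matrix.unitaryGroup (Fin 2 × Fin 2) ℂ × Matrix.unitaryGroup (Fin 2) ℂ) => p.1 := continuous_fst
  have hU : Continuous fun p : (Fin 2 × Fin 2 → Fin 2 × Fin 2 → ℂ) ×
    (Matrix.unitaryGroup (Fin 2 × Fin 2) ℂ × Matrix.unitaryGroup (Fin 2) ℂ) => p.2.1.1 :=
    continuous_subtype_val.comp (continuous_fst.comp continuous_snd)
  have hV : Continuous fun p : (Fin 2 × Fin 2 → Fin 2 × Fin 2 → ℂ) ×
    (Matrix.unitaryGroup (Fin 2 × Fin 2) ℂ × Matrix.unitaryGroup (Fin 2) ℂ) => p.2.2.1 :=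
    continuous_subtype_val.comp (continuous_snd.comp continuous_snd)
  have h1 : IsClosed {p : (Fin 2 × Fin 2 → Fin 2 × Fin 2 → ℂ) ×
      (Matrix.unitaryGroup (Fin 2 × Fin 2) ℂ × Matrix.unitaryGroup (Fin 2) ℂ) |
      ∀ i j, i ≠ j → detPol (coeffMat (mix p.2.1.1 p.1 i)) (coeffMat (mix p.2.1.1 p.1 j)) = 0} := by
    simp only [Set.ofPred_forall]
    exact isClosed_iInter fun i => isClosed_iInter fun j => isClosed_iInter fun _ =>
      isClosed_eq (continuous_detPol_coeffMat (continuous_mix hU hfst i) (continuous_mix hU hfst j))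
        continuous_const
  have h2 : IsClosed {p : (Fin 2 × Fin 2 → Fin 2 × Fin 2 → ℂ) ×
      (Matrix.unitaryGroup (Fin 2 × Fin 2) ℂ × Matrix.unitaryGroup (Fin 2) ℂ) |
      ‖signedDet (mix p.2.1.1 p.1)‖ ^ 2 ≤ condGap p.2.2.1 (∑ j, pureDM (p.1 j))} :=
    isClosed_le ((continuous_signedDet (continuous_mix hU hfst)).norm.pow 2)
      (continuous_condGap hV (continuous_sum_pureDM hfst))
  have himg := isClosedMap_fst_of_compactSpace _ (h1.inter h2)
  obtain ⟨⟨G', U, V⟩, ⟨h1, h2⟩, rfl⟩ := himg.closure_subset_iff.mpr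
    (fun G (hG : (Matrix.of G).det ≠ 0) => by
      obtain ⟨U, hU, V, hV, h1, h2⟩ := exists_mix_of_det_ne_zero hG
      exact ⟨(G, ⟨U, hU⟩, ⟨V, hV⟩), ⟨h1, h2⟩, rfl⟩)
    (dense_det_ne_zero (Fin 2 × Fin 2) (Matrix.of G))
  exact ⟨U.1, U.2, V.1, V.2, h1, h2⟩

/-- The `4 × 4` Hadamard matrix with phases, making all mixed determinants equal. -/
def phasedHadamard : Matrix (Fin 2 × Fin 2) (Fin 2 × Fin 2) ℂ :=
  Matrix.of fun i k => (1 / 2) * (if k.1 = 0 then 1 else Complex.I) *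
    (if i.1 = 1 ∧ k.1 = 1 then -1 else 1) * (if i.2 = 1 ∧ k.2 = 1 then -1 else 1)

theorem phasedHadamard_mem_unitaryGroup :
    phasedHadamard ∈ Matrix.unitaryGroup (Fin 2 × Fin 2) ℂ := by
  rw [Matrix.mem_unitaryGroup_iff']
  ext ⟨a, b⟩ ⟨c, d⟩
  fin_cases a <;> fin_cases b <;> fin_cases c <;> fin_cases d <;>
    simp [phasedHadamard, Matrix.mul_apply, Fintype.sum_prod_type, Fin.sum_univ_two,
      map_ofNat] <;> ring_nf <;> norm_num

theorem det_coeffMat_mix_phasedHadamard {W : Fin 2 × Fin 2 → Fin 2 × Fin 2 → ℂ}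
    (hW : ∀ i j, i ≠ j → detPol (coeffMat (W i)) (coeffMat (W j)) = 0) (j : Fin 2 × Fin 2) :
    (coeffMat (mix phasedHadamard W j)).det = signedDet W / 4 := by
  have hd : Matrix.of (fun k l => detPol (coeffMat (W k)) (coeffMat (W l))) =
      Matrix.diagonal fun k => 2 * (coeffMat (W k)).det := by
    ext k l
    by_cases h : k = l
    · subst h; simp [detPol_self]
    · rw [Matrix.of_apply, hW k l h, Matrix.diagonal_apply_ne _ h]
  have h := detPol_mix phasedHadamard W j j
  rw [hd, detPol_self, Matrix.mul_apply] at h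
  simp only [Matrix.mul_diagonal, Matrix.transpose_apply, Fintype.sum_prod_type,
    Fin.sum_univ_two] at h
  have : ∀ k, phasedHadamard j k * phasedHadamard j k = if k.1 = 0 then 1 / 4 else -(1 / 4) := by
    rintro ⟨a, b⟩
    simp only [phasedHadamard, Matrix.of_apply]
    fin_cases a <;> simp <;> split_ifs <;> ring_nf <;> simp <;> ring
  have e := fun k (z : ℂ) => congrArg (· * z) (this k)
  have e1 := e (0, 0) (coeffMat (W (0, 0))).det
  have e2 := e (0, 1) (coeffMat (W (0, 1))).det
  have e3 := e (1, 0) (coeffMat (W (1, 0))).det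
  have e4 := e (1, 1) (coeffMat (W (1, 1))).det
  simp only [if_true, one_ne_zero, if_false] at e1 e2 e3 e4
  rw [signedDet]
  linear_combination h / 2 + e1 + e2 + e3 + e4

/-- The matrix `ρ` has an ensemble decomposition of average concurrence `c`. -/
def HasDecomp (ρ : Matrix (Fin 2 × Fin 2) (Fin 2 × Fin 2) ℂ) (c : ℝ) : Prop :=
  ∃ (n : ℕ) (w : Fin n → Fin 2 × Fin 2 → ℂ), ρ = ∑ k, pureDM (w k) ∧
    c = ∑ k, 2 * ‖(coeffMat (w k)).det‖

theorem HasDecomp.of_fintype {ι : Type*} [Fintype ι] (w : ι → Fin 2 × Fin 2 → ℂ) :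
    HasDecomp (∑ k, pureDM (w k)) (∑ k, 2 * ‖(coeffMat (w k)).det‖) := by
  let e := Fintype.equivFin ι
  exact ⟨Fintype.card ι, fun i => w (e.symm i), (e.symm.sum_comp fun k => pureDM (w k)).symm,
    (e.symm.sum_comp fun k => 2 * ‖(coeffMat (w k)).det‖).symm⟩

theorem HasDecomp.add {ρ σ : Matrix (Fin 2 × Fin 2) (Fin 2 × Fin 2) ℂ} {c d : ℝ}
    (hρ : HasDecomp ρ c) (hσ : HasDecomp σ d) : HasDecomp (ρ + σ) (c + d) := by
  obtain ⟨m, v, rfl, rfl⟩ := hρ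
  obtain ⟨n, w, rfl, rfl⟩ := hσ
  have := HasDecomp.of_fintype (Sum.elim v w)
  simpa only [Fintype.sum_sum_type, Sum.elim_inl, Sum.elim_inr] using this

theorem HasDecomp.nonneg {ρ : Matrix (Fin 2 × Fin 2) (Fin 2 × Fin 2) ℂ} {c : ℝ}
    (h : HasDecomp ρ c) : 0 ≤ c := by
  obtain ⟨n, w, -, rfl⟩ := h
  positivity

theorem HasDecomp.conc_le {ρ : Matrix (Fin 2 × Fin 2) (Fin 2 × Fin 2) ℂ} {c : ℝ}
    (h : HasDecomp ρ c) (hρ : ρ.trace = 1) : conc ρ ≤ c := by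
  obtain ⟨n, w, rfl, rfl⟩ := h
  refine conc_le_of_mem (mem_concSet rfl ?_)
  rw [Matrix.trace_sum] at hρ
  simp only [trace_pureDM] at hρ
  exact_mod_cast hρ

open scoped ComplexOrder MatrixOrder in
/-- Any finite ensemble can be replaced by one indexed by the underlying basis. -/
theorem exists_square_ensemble {ι κ : Type*} [Fintype ι] [Fintype κ] [DecidableEq κ]
    (w : ι → κ → ℂ) : ∃ G : κ → κ → ℂ, ∑ k, pureDM (w k) = ∑ j, pureDM (G j) := by
  have h : (∑ k, pureDM (w k)).PosSemidef :=
    Matrix.posSemidef_sum _ fun k _ => Matrix.posSemidef_vecMulVec_self_star (w k)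
  set P := CFC.sqrt (∑ k, pureDM (w k)) with hP
  have hPP : P * P = ∑ k, pureDM (w k) := CFC.sqrt_mul_sqrt_self _ h.nonneg
  have hPh : P.IsHermitian := (Matrix.nonneg_iff_posSemidef.mp (CFC.sqrt_nonneg _)).isHermitian
  refine ⟨fun j x => P x j, ?_⟩
  rw [← hPP]
  ext x y
  rw [Matrix.mul_apply, Matrix.sum_apply]
  refine Finset.sum_congr rfl fun j _ => ?_
  rw [pureDM, ← Complex.star_def, hPh.apply]

theorem exists_hasDecomp_sq_le {ι : Type*} [Fintype ι] (w : ι → Fin 2 × Fin 2 → ℂ) :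
    ∃ V ∈ Matrix.unitaryGroup (Fin 2) ℂ, ∃ c : ℝ, HasDecomp (∑ k, pureDM (w k)) c ∧
      c ^ 2 ≤ 4 * condGap V (∑ k, pureDM (w k)) := by
  obtain ⟨G, hG⟩ := exists_square_ensemble w
  rw [hG]
  obtain ⟨U, hU, V, hV, hoff, hle⟩ := exists_mix G
  refine ⟨V, hV, 2 * ‖signedDet (mix U G)‖, ?_, by rw [mul_pow]; linarith⟩
  have := HasDecomp.of_fintype (mix phasedHadamard (mix U G))
  rw [sum_pureDM_mix phasedHadamard_mem_unitaryGroup, sum_pureDM_mix hU] at this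
  simp only [det_coeffMat_mix_phasedHadamard hoff] at this
  convert this using 1
  simp
  ring

/-- The reduced matrix on the first qubit and the `i`-th environment qubit of an unnormalized
vector `φ`. -/
def pairDM {n : ℕ} (φ : Fin 2 → (Fin n → Fin 2) → ℂ) (i : Fin n) :
    Matrix (Fin 2 × Fin 2) (Fin 2 × Fin 2) ℂ :=
  Matrix.of fun s t => ∑ x : Fin n → Fin 2,
    if x i = s.2 then φ s.1 x * (starRingEnd ℂ) (φ t.1 (Function.update x i t.2)) else 0

/-- The reduced matrix on the first qubit of an unnormalized vector `φ`. -/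
def gramMat {X : Type*} [Fintype X] (φ : Fin 2 → X → ℂ) : Matrix (Fin 2) (Fin 2) ℂ :=
  Matrix.of fun a a' => ∑ x, φ a x * (starRingEnd ℂ) (φ a' x)

theorem sum_cons {M : Type*} [AddCommMonoid M] {n : ℕ} (f : (Fin (n + 1) → Fin 2) → M) :
    ∑ x, f x = ∑ b, ∑ x : Fin n → Fin 2, f (Fin.cons b x) := by
  rw [← Fintype.sum_prod_type']
  exact ((Fin.consEquiv fun _ => Fin 2).sum_comp f).symm

theorem pairDM_zero {n : ℕ} (φ : Fin 2 → (Fin (n + 1) → Fin 2) → ℂ) :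
    pairDM φ 0 = ∑ x : Fin n → Fin 2, pureDM fun s => φ s.1 (Fin.cons s.2 x) := by
  ext s t
  simp only [pairDM, Matrix.of_apply, Matrix.sum_apply, pureDM, sum_cons, Fin.cons_zero,
    Fin.update_cons_zero]
  rw [Finset.sum_comm]
  simp

theorem pairDM_succ {n : ℕ} (φ : Fin 2 → (Fin (n + 1) → Fin 2) → ℂ) (i : Fin n) :
    pairDM φ i.succ = ∑ b, pairDM (fun a x => φ a (Fin.cons b x)) i := by
  ext s t
  simp only [pairDM, Matrix.of_apply, Matrix.sum_apply, sum_cons, Fin.cons_succ, Fin.cons_update]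

theorem sum_unitary_mul_conj {κ : Type*} [Fintype κ] [DecidableEq κ] {U : Matrix κ κ ℂ}
    (hU : U ∈ Matrix.unitaryGroup κ ℂ) (f g : κ → ℂ) :
    ∑ k, (∑ b, U k b * f b) * (starRingEnd ℂ) (∑ b, U k b * g b) =
      ∑ b, f b * (starRingEnd ℂ) (g b) := by
  have h := congrFun (congrFun (sum_pureDM_mix hU fun k (x : Bool) => if x then f k else g k) true)
    false
  simpa only [Matrix.sum_apply, pureDM, mix, if_true, Bool.false_eq_true, if_false] using h

theorem sum_pairDM_mix {n : ℕ} {V : Matrix (Fin 2) (Fin 2) ℂ}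
    (hV : V ∈ Matrix.unitaryGroup (Fin 2) ℂ) (φ : Fin 2 → Fin 2 → (Fin n → Fin 2) → ℂ)
    (i : Fin n) :
    ∑ k, pairDM (fun a x => ∑ b, V k b * φ b a x) i = ∑ b, pairDM (φ b) i := by
  ext s t
  simp only [pairDM, Matrix.of_apply, Matrix.sum_apply]
  rw [Finset.sum_comm, Finset.sum_comm (s := (Finset.univ : Finset (Fin 2)))]
  refine Finset.sum_congr rfl fun x _ => ?_
  by_cases h : x i = s.2
  · simp only [h, if_true]
    exact sum_unitary_mul_conj hV _ _
  · simp [h]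

theorem condRed_eq_gramMat {X : Type*} [Fintype X] (V : Matrix (Fin 2) (Fin 2) ℂ)
    (φ : Fin 2 → Fin 2 → X → ℂ) (k : Fin 2) :
    condRed V (∑ x, pureDM fun s => φ s.2 s.1 x) k =
      gramMat fun a x => ∑ b, V k b * φ b a x := by
  rw [condRed_sum]
  ext a a'
  simp only [Matrix.sum_apply, condRed, gramMat, Matrix.of_apply, pureDM, map_sum, map_mul,
    Finset.sum_mul_sum]
  refine Finset.sum_congr rfl fun x _ => Finset.sum_congr rfl fun b _ =>
    Finset.sum_congr rfl fun b' _ => ?_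
  ring

theorem gramMat_mix {X : Type*} [Fintype X] {V : Matrix (Fin 2) (Fin 2) ℂ}
    (hV : V ∈ Matrix.unitaryGroup (Fin 2) ℂ) (φ : Fin 2 → Fin 2 → X → ℂ) :
    ∑ k, gramMat (fun a x => ∑ b, V k b * φ b a x) = ∑ b, gramMat (φ b) := by
  ext a a'
  simp only [gramMat, Matrix.sum_apply, Matrix.of_apply]
  rw [Finset.sum_comm, Finset.sum_comm (s := (Finset.univ : Finset (Fin 2)))]
  exact Finset.sum_congr rfl fun x _ => sum_unitary_mul_conj hV _ _

theorem sum_add_sq_le {ι : Type*} [Fintype ι] {r s : ι → ℝ} {c d : ℝ}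
    (hd : 0 ≤ d) (hr : ∑ i, r i ^ 2 ≤ 4 * c) (hs : ∑ i, s i ^ 2 ≤ 4 * d) :
    ∑ i, (r i + s i) ^ 2 ≤ 4 * (c + d + 2 * √(c * d)) := by
  have hc : 0 ≤ c := by
    have := Finset.sum_nonneg fun i (_ : i ∈ Finset.univ) => sq_nonneg (r i)
    linarith
  have h1 : ∑ i, r i * s i ≤ 4 * √(c * d) := by
    refine (abs_le_of_sq_le_sq' ?_ (by positivity)).2
    rw [mul_pow, Real.sq_sqrt (mul_nonneg hc hd)]
    calc (∑ i, r i * s i) ^ 2 ≤ (∑ i, r i ^ 2) * ∑ i, s i ^ 2 :=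
          Finset.sum_mul_sq_le_sq_mul_sq _ _ _
      _ ≤ (4 * c) * (4 * d) := mul_le_mul hr hs (by positivity) (by positivity)
      _ = 4 ^ 2 * (c * d) := by ring
  have h2 : ∑ i, (r i + s i) ^ 2 = ∑ i, r i ^ 2 + ∑ i, s i ^ 2 + 2 * ∑ i, r i * s i := by
    rw [Finset.mul_sum, ← Finset.sum_add_distrib, ← Finset.sum_add_distrib]
    exact Finset.sum_congr rfl fun i _ => by ring
  rw [h2]
  linarith

/-- An ensemble form of the Osborne–Verstraete monogamy inequality. -/
theorem exists_hasDecomp_pairDM {n : ℕ} (φ : Fin 2 → (Fin n → Fin 2) → ℂ) :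
    ∃ r : Fin n → ℝ, (∀ i, HasDecomp (pairDM φ i) (r i)) ∧
      ∑ i, r i ^ 2 ≤ 4 * (gramMat φ).det.re := by
  induction n with
  | zero =>
    refine ⟨fun _ => 0, fun i => i.elim0, ?_⟩
    have : (gramMat φ).det = 0 := by
      simp only [gramMat, Matrix.det_fin_two, Matrix.of_apply, Fintype.sum_unique]
      ring
    simp [this]
  | succ n ih =>
    obtain ⟨V, hV, c, hc, hle⟩ := exists_hasDecomp_sq_le
      fun (x : Fin n → Fin 2) (s : Fin 2 × Fin 2) => φ s.1 (Fin.cons s.2 x)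
    have hp0 := condRed_det_re_nonneg V
      (fun (x : Fin n → Fin 2) (s : Fin 2 × Fin 2) => φ s.1 (Fin.cons s.2 x)) 1
    rw [condGap] at hle
    have hR := condRed_eq_gramMat V fun b a (x : Fin n → Fin 2) => φ a (Fin.cons b x)
    rw [hR] at hp0
    rw [hR, hR] at hle
    have hsum : (gramMat φ) = gramMat (fun a (x : Fin n → Fin 2) => ∑ b, V 0 b * φ a (Fin.cons b x)) +
        gramMat (fun a (x : Fin n → Fin 2) => ∑ b, V 1 b * φ a (Fin.cons b x)) := by
      rw [← Fin.sum_univ_two fun k =>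
        gramMat fun a (x : Fin n → Fin 2) => ∑ b, V k b * φ a (Fin.cons b x),
        gramMat_mix hV fun b a (x : Fin n → Fin 2) => φ a (Fin.cons b x)]
      ext a a'
      simp only [gramMat, Matrix.of_apply, Matrix.sum_apply, sum_cons]
    obtain ⟨r, hr, hr2⟩ := ih fun a x => ∑ b, V 0 b * φ a (Fin.cons b x)
    obtain ⟨s, hs, hs2⟩ := ih fun a x => ∑ b, V 1 b * φ a (Fin.cons b x)
    refine ⟨Fin.cons c fun i => r i + s i, fun i => ?_, ?_⟩
    · refine Fin.cases ?_ (fun i => ?_) i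
      · rw [pairDM_zero]; exact hc
      · rw [pairDM_succ, ← sum_pairDM_mix hV fun b a (x : Fin n → Fin 2) => φ a (Fin.cons b x),
          Fin.sum_univ_two]
        exact (hr i).add (hs i)
    · rw [Fin.sum_univ_succ]
      simp only [Fin.cons_zero, Fin.cons_succ]
      have h := sum_add_sq_le hp0 hr2 hs2
      have hdet := det_smul_add_smul 1 1
        (gramMat (fun a (x : Fin n → Fin 2) => ∑ b, V 0 b * φ a (Fin.cons b x)))
        (gramMat (fun a (x : Fin n → Fin 2) => ∑ b, V 1 b * φ a (Fin.cons b x)))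
      rw [one_smul, one_smul, ← hsum] at hdet
      rw [hdet]
      simp only [one_pow, one_mul, Complex.add_re]
      linarith

theorem gramMat_det_re_nonneg {X : Type*} [Fintype X] (φ : Fin 2 → X → ℂ) :
    0 ≤ (gramMat φ).det.re := by
  have h := condRed_det_re_nonneg 1 (fun x (s : Fin 2 × Fin 2) => if s.2 = 0 then φ s.1 x else 0) 0
  rw [condRed_eq_gramMat 1 fun b a x => if b = 0 then φ a x else 0] at h
  simpa [Matrix.one_apply] using h

/-- The reduced matrix on the second factor of an unnormalized vector `φ`. -/
def envMat {X : Type*} (φ : Fin 2 → X → ℂ) : Matrix X X ℂ :=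
  Matrix.of fun x y => ∑ a, φ a x * (starRingEnd ℂ) (φ a y)

theorem trace_gramMat {X : Type*} [Fintype X] (φ : Fin 2 → X → ℂ) :
    (gramMat φ).trace = ((∑ a, ∑ x, ‖φ a x‖ ^ 2 : ℝ) : ℂ) := by
  simp [Matrix.trace, gramMat, Complex.mul_conj, Complex.normSq_eq_norm_sq]

theorem trSq_gramMat {X : Type*} [Fintype X] (φ : Fin 2 → X → ℂ) :
    trSq (gramMat φ) = (∑ a, ∑ x, ‖φ a x‖ ^ 2) ^ 2 - 2 * (gramMat φ).det.re := by
  have h : (gramMat φ * gramMat φ).trace = (gramMat φ).trace ^ 2 - 2 * (gramMat φ).det := by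
    simp only [Matrix.trace, Matrix.diag_apply, Matrix.mul_apply, Fin.sum_univ_two,
      Matrix.det_fin_two]
    ring
  rw [trSq, h, trace_gramMat, ← Complex.ofReal_pow, Complex.sub_re, Complex.ofReal_re]
  simp

theorem trSq_envMat {X : Type*} [Fintype X] (φ : Fin 2 → X → ℂ) :
    trSq (envMat φ) = trSq (gramMat φ) := by
  simp only [trSq, envMat, gramMat, Matrix.trace, Matrix.diag_apply, Matrix.mul_apply,
    Matrix.of_apply, Finset.sum_mul_sum]
  congr 1
  calc _ = ∑ x, ∑ a, ∑ y, ∑ b, φ a x * (starRingEnd ℂ) (φ a y) * (φ b y * (starRingEnd ℂ) (φ b x)) :=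
        Finset.sum_congr rfl fun x _ => Finset.sum_comm
    _ = ∑ a, ∑ x, ∑ b, ∑ y, φ a x * (starRingEnd ℂ) (φ a y) * (φ b y * (starRingEnd ℂ) (φ b x)) := by
        rw [Finset.sum_comm]
        exact Finset.sum_congr rfl fun a _ => Finset.sum_congr rfl fun x _ => Finset.sum_comm
    _ = ∑ a, ∑ b, ∑ x, ∑ y, φ a x * (starRingEnd ℂ) (φ a y) * (φ b y * (starRingEnd ℂ) (φ b x)) :=
        Finset.sum_congr rfl fun a _ => Finset.sum_comm
    _ = _ := Finset.sum_congr rfl fun a _ => Finset.sum_congr rfl fun b _ =>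
        Finset.sum_congr rfl fun x _ => Finset.sum_congr rfl fun y _ => by ring

theorem trSq_add {X : Type*} [Fintype X] (A B : Matrix X X ℂ) :
    trSq (A + B) = trSq A + trSq B + 2 * ((A * B).trace).re := by
  simp only [trSq, Matrix.add_mul, Matrix.mul_add, Matrix.trace_add, Complex.add_re,
    Matrix.trace_mul_comm B A]
  ring

theorem re_trace_mul_sq_le {X : Type*} [Fintype X] {A B : Matrix X X ℂ} (hA : A.IsHermitian)
    (hB : B.IsHermitian) : ((A * B).trace.re) ^ 2 ≤ trSq A * trSq B := by
  have key : ∀ {C D : Matrix X X ℂ}, D.IsHermitian → (C * D).trace.re =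
      ∑ p : (X × X) × Bool, (if p.2 then (C p.1.1 p.1.2).re else (C p.1.1 p.1.2).im) *
        (if p.2 then (D p.1.1 p.1.2).re else (D p.1.1 p.1.2).im) := by
    intro C D hD
    simp only [Matrix.trace, Matrix.diag_apply, Matrix.mul_apply, Complex.re_sum,
      Fintype.sum_prod_type, Fintype.sum_bool, if_true, Bool.false_eq_true, if_false]
    refine Finset.sum_congr rfl fun x _ => Finset.sum_congr rfl fun y _ => ?_
    rw [← hD.apply y x, Complex.mul_re]
    simp
  rw [trSq, trSq, key hA, key hB, key hB]
  simp only [← sq]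
  exact Finset.sum_mul_sq_le_sq_mul_sq _ _ _

theorem trSq_nonneg {X : Type*} [Fintype X] {A : Matrix X X ℂ} (hA : A.IsHermitian) :
    0 ≤ trSq A := by
  simp only [trSq, Matrix.trace, Matrix.diag_apply, Matrix.mul_apply, Complex.re_sum]
  refine Finset.sum_nonneg fun x _ => Finset.sum_nonneg fun y _ => ?_
  rw [← hA.apply y x, Complex.star_def, Complex.mul_conj, Complex.ofReal_re]
  exact Complex.normSq_nonneg _

theorem envMat_isHermitian {X : Type*} (φ : Fin 2 → X → ℂ) : (envMat φ).IsHermitian := by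
  ext x y
  simp [envMat, mul_comm]

/-- Bound on the concurrences of the pairs `A C_i` of a normalized vector on `A B C₁ … C_n` in terms
of purities. -/
theorem exists_hasDecomp_sum_sq_le {n : ℕ} (Ψ : Fin 2 → Fin 2 → (Fin n → Fin 2) → ℂ)
    (hΨ : ∑ b, ∑ a, ∑ c, ‖Ψ b a c‖ ^ 2 = 1)
    (hsub : trSq (gramMat fun b (p : Fin 2 × (Fin n → Fin 2)) => Ψ b p.1 p.2) +
      trSq (∑ b, envMat (Ψ b)) ≤ 1 + trSq (∑ b, gramMat (Ψ b))) :
    ∃ r : Fin n → ℝ, (∀ i, HasDecomp (∑ b, pairDM (Ψ b) i) (r i)) ∧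
      ∑ i, r i ^ 2 ≤ 3 * (1 - trSq (∑ b, envMat (Ψ b))) +
        (1 - trSq (gramMat fun b (p : Fin 2 × (Fin n → Fin 2)) => Ψ b p.1 p.2)) -
        (1 - trSq (∑ b, gramMat (Ψ b))) := by
  obtain ⟨r, hr, hr2⟩ := exists_hasDecomp_pairDM (Ψ 0)
  obtain ⟨s, hs, hs2⟩ := exists_hasDecomp_pairDM (Ψ 1)
  refine ⟨fun i => r i + s i, fun i => ?_, ?_⟩
  · rw [Fin.sum_univ_two]; exact (hr i).add (hs i)
  have hd0 := gramMat_det_re_nonneg (Ψ 0)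
  have hd1 := gramMat_det_re_nonneg (Ψ 1)
  have hle := sum_add_sq_le hd1 hr2 hs2
  refine hle.trans ?_
  have hB : trSq (gramMat fun b (p : Fin 2 × (Fin n → Fin 2)) => Ψ b p.1 p.2) =
      (∑ a, ∑ c, ‖Ψ 0 a c‖ ^ 2) ^ 2 + (∑ a, ∑ c, ‖Ψ 1 a c‖ ^ 2) ^ 2 +
        2 * ‖∑ a, ∑ c, Ψ 0 a c * (starRingEnd ℂ) (Ψ 1 a c)‖ ^ 2 := by
    have hdet : (gramMat fun b (p : Fin 2 × (Fin n → Fin 2)) => Ψ b p.1 p.2).det.re =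
        (∑ a, ∑ c, ‖Ψ 0 a c‖ ^ 2) * (∑ a, ∑ c, ‖Ψ 1 a c‖ ^ 2) -
          ‖∑ a, ∑ c, Ψ 0 a c * (starRingEnd ℂ) (Ψ 1 a c)‖ ^ 2 := by
      rw [← Complex.normSq_eq_norm_sq, ← Complex.ofReal_re (_ - _), Complex.ofReal_sub,
        ← Complex.mul_conj]
      simp only [gramMat, Matrix.det_fin_two, Matrix.of_apply, Complex.mul_conj,
        Complex.normSq_eq_norm_sq, map_sum, map_mul, Complex.conj_conj, Complex.ofReal_sum,
        Complex.ofReal_mul, Fintype.sum_prod_type, mul_comm]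
    rw [trSq_gramMat, hdet]
    simp only [Fintype.sum_prod_type, Fin.sum_univ_two (fun b : Fin 2 =>
      ∑ a : Fin 2, ∑ c : Fin n → Fin 2, ‖Ψ b a c‖ ^ 2)]
    ring
  have hK := re_trace_mul_sq_le (envMat_isHermitian (Ψ 0)) (envMat_isHermitian (Ψ 1))
  rw [Fin.sum_univ_two fun b => envMat (Ψ b), Fin.sum_univ_two fun b => gramMat (Ψ b), trSq_add,
    trSq_add, hB, trSq_envMat, trSq_envMat] at hsub ⊢
  rw [Fin.sum_univ_two fun b => ∑ a, ∑ c, ‖Ψ b a c‖ ^ 2] at hΨ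
  rw [trSq_envMat, trSq_envMat] at hK
  have ha := trSq_gramMat (Ψ 0)
  have hb := trSq_gramMat (Ψ 1)
  set a := trSq (gramMat (Ψ 0))
  set b := trSq (gramMat (Ψ 1))
  set p := ∑ a, ∑ c, ‖Ψ 0 a c‖ ^ 2
  set q := ∑ a, ∑ c, ‖Ψ 1 a c‖ ^ 2
  set d := (gramMat (Ψ 0)).det.re
  set e := (gramMat (Ψ 1)).det.re
  have ha0 : 0 ≤ a := (trSq_nonneg (envMat_isHermitian (Ψ 0))).trans_eq (trSq_envMat _)
  have hb0 : 0 ≤ b := (trSq_nonneg (envMat_isHermitian (Ψ 1))).trans_eq (trSq_envMat _)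
  set K := (envMat (Ψ 0) * envMat (Ψ 1)).trace.re
  set t := ‖∑ a, ∑ c, Ψ 0 a c * (starRingEnd ℂ) (Ψ 1 a c)‖ ^ 2
  set g := (gramMat (Ψ 0) * gramMat (Ψ 1)).trace.re
  have hp : 0 ≤ p := by positivity
  have hq : 0 ≤ q := by positivity
  have hKab : K ≤ √(a * b) := Real.le_sqrt_of_sq_le hK
  have hde : 2 * √(d * e) ≤ p * q - √(a * b) := by
    have hsa := Real.sq_sqrt ha0
    have hsb := Real.sq_sqrt hb0
    have hap : √a ≤ p := (Real.sqrt_le_left hp).2 (by linarith)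
    have hbq : √b ≤ q := (Real.sqrt_le_left hq).2 (by linarith)
    have hab := mul_le_mul hap hbq (Real.sqrt_nonneg b) hp
    rw [Real.sqrt_mul ha0]
    refine (abs_le_of_sq_le_sq' ?_ (by linarith)).2
    rw [mul_pow, Real.sq_sqrt (mul_nonneg hd0 hd1)]
    nlinarith [sq_nonneg (p * √b - q * √a), sq_nonneg √a, sq_nonneg √b]
  have hpq : q = 1 - p := by linarith
  rw [hpq] at *
  nlinarith

/-- The part of `H` that changes sign under the involution `σ`, up to a factor of two. -/
def antiPart {Z : Type*} (σ : Z → Z) (H : Z → ℂ) : Z → ℂ := fun z => H z - H (σ z)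

theorem antiPart_comm {Z : Type*} {σ τ : Z → Z} (h : ∀ z, σ (τ z) = τ (σ z)) (H : Z → ℂ) :
    antiPart σ (antiPart τ H) = antiPart τ (antiPart σ H) := by
  funext z
  simp only [antiPart, h]
  ring

theorem sum_antiPart_mul_conj {Z : Type*} [Fintype Z] {σ : Z → Z} (hσ : Function.Involutive σ)
    (H K : Z → ℂ) :
    ∑ z, antiPart σ H z * (starRingEnd ℂ) (antiPart σ K z) =
      2 * ∑ z, antiPart σ H z * (starRingEnd ℂ) (K z) := by
  have h : ∑ z, antiPart σ H z * (starRingEnd ℂ) (K (σ z)) =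
      -∑ z, antiPart σ H z * (starRingEnd ℂ) (K z) := by
    rw [← Equiv.sum_comp (hσ.toPerm σ), ← Finset.sum_neg_distrib]
    refine Finset.sum_congr rfl fun z _ => ?_
    simp only [Function.Involutive.coe_toPerm, antiPart, hσ z]
    ring
  have h' : ∑ z, antiPart σ H z * (starRingEnd ℂ) (antiPart σ K z) =
      ∑ z, antiPart σ H z * (starRingEnd ℂ) (K z) -
        ∑ z, antiPart σ H z * (starRingEnd ℂ) (K (σ z)) := by
    rw [← Finset.sum_sub_distrib]
    exact Finset.sum_congr rfl fun z _ => by rw [antiPart, antiPart, map_sub, mul_sub]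
  rw [h', h]
  ring

section Purity

variable {ι : Type*} [DecidableEq ι]

/-- Exchange the coordinates in `S` between two configurations. -/
def swapOn (S : Finset ι) (z : (ι → Fin 2) × (ι → Fin 2)) : (ι → Fin 2) × (ι → Fin 2) :=
  (S.piecewise z.2 z.1, S.piecewise z.1 z.2)

theorem swapOn_involutive (S : Finset ι) : Function.Involutive (swapOn S) := by
  rintro ⟨x, y⟩
  ext i <;> by_cases h : i ∈ S <;> simp [swapOn, h]

theorem swapOn_comm (S T : Finset ι) (z : (ι → Fin 2) × (ι → Fin 2)) :
    swapOn S (swapOn T z) = swapOn T (swapOn S z) := by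
  ext i <;> by_cases h : i ∈ S <;> by_cases h' : i ∈ T <;> simp [swapOn, h, h']

theorem swapOn_swapOn {S T : Finset ι} (hST : Disjoint S T) (z : (ι → Fin 2) × (ι → Fin 2)) :
    swapOn S (swapOn T z) = swapOn (S ∪ T) z := by
  ext i <;> by_cases h : i ∈ S <;> by_cases h' : i ∈ T <;>
    first
      | exact absurd h' (Finset.disjoint_left.1 hST h)
      | simp [swapOn, h, h']

variable [Fintype ι]

/-- Two copies of the vector `ψ`. -/
def twoCopies (ψ : (ι → Fin 2) → ℂ) (z : (ι → Fin 2) × (ι → Fin 2)) : ℂ := ψ z.1 * ψ z.2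

/-- The purity `Tr ρ_S²` of the reduction of `ψ` to the qubits in `S`. -/
def purity (S : Finset ι) (ψ : (ι → Fin 2) → ℂ) : ℝ :=
  (∑ z, twoCopies ψ (swapOn S z) * (starRingEnd ℂ) (twoCopies ψ z)).re

theorem purity_compl (S : Finset ι) (ψ : (ι → Fin 2) → ℂ) : purity Sᶜ ψ = purity S ψ := by
  simp only [purity, swapOn, twoCopies, Finset.piecewise_compl, mul_comm (ψ _) (ψ _)]

theorem sum_twoCopies {ψ : (ι → Fin 2) → ℂ} (hψ : ∑ x, ‖ψ x‖ ^ 2 = 1) :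
    ∑ z, twoCopies ψ z * (starRingEnd ℂ) (twoCopies ψ z) = 1 := by
  have h : ∑ x, ψ x * (starRingEnd ℂ) (ψ x) = 1 := by
    simp only [Complex.mul_conj, Complex.normSq_eq_norm_sq]
    exact_mod_cast hψ
  rw [Fintype.sum_prod_type, ← one_mul (1 : ℂ), ← h, Finset.sum_mul_sum]
  refine Finset.sum_congr rfl fun x _ => Finset.sum_congr rfl fun y _ => ?_
  simp only [twoCopies, map_mul]
  ring

theorem purity_empty {ψ : (ι → Fin 2) → ℂ} (hψ : ∑ x, ‖ψ x‖ ^ 2 = 1) : purity ∅ ψ = 1 := by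
  have := sum_twoCopies hψ
  simp only [purity, swapOn, Finset.piecewise_empty, this, Complex.one_re]

theorem purity_univ {ψ : (ι → Fin 2) → ℂ} (hψ : ∑ x, ‖ψ x‖ ^ 2 = 1) :
    purity Finset.univ ψ = 1 := by
  rw [← purity_compl, Finset.compl_univ, purity_empty hψ]

/-- The mutual linear entropy of the disjoint sets of qubits `S` and `T`. -/
def mutualEnt (S T : Finset ι) (ψ : (ι → Fin 2) → ℂ) : ℝ :=
  1 - purity S ψ - purity T ψ + purity (S ∪ T) ψ

theorem sum_norm_antiPart_two {ψ : (ι → Fin 2) → ℂ} (hψ : ∑ x, ‖ψ x‖ ^ 2 = 1) {S T : Finset ι}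
    (hST : Disjoint S T) :
    ∑ z, ‖antiPart (swapOn S) (antiPart (swapOn T) (twoCopies ψ)) z‖ ^ 2 =
      4 * mutualEnt S T ψ := by
  have h : ∀ H : (ι → Fin 2) × (ι → Fin 2) → ℂ,
      ∑ z, ‖H z‖ ^ 2 = (∑ z, H z * (starRingEnd ℂ) (H z)).re := fun H => by
    simp only [Complex.mul_conj, Complex.normSq_eq_norm_sq, Complex.re_sum, Complex.ofReal_re]
  rw [h, sum_antiPart_mul_conj (swapOn_involutive S), antiPart_comm (swapOn_comm S T),
    sum_antiPart_mul_conj (swapOn_involutive T)]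
  simp only [antiPart, sub_mul, Finset.sum_sub_distrib, sum_twoCopies hψ,
    swapOn_swapOn hST]
  simp [mutualEnt, purity]
  ring

theorem mutualEnt_nonneg {ψ : (ι → Fin 2) → ℂ} (hψ : ∑ x, ‖ψ x‖ ^ 2 = 1) {S T : Finset ι}
    (hST : Disjoint S T) : 0 ≤ mutualEnt S T ψ := by
  have h := Finset.sum_nonneg fun z (_ : z ∈ Finset.univ) =>
    sq_nonneg ‖antiPart (swapOn S) (antiPart (swapOn T) (twoCopies ψ)) z‖
  rw [sum_norm_antiPart_two hψ hST] at h
  linarith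

/-- The mutual linear entropy is subadditive in its second argument. -/
theorem mutualEnt_union_le {ψ : (ι → Fin 2) → ℂ} (hψ : ∑ x, ‖ψ x‖ ^ 2 = 1) {S T U : Finset ι}
    (hST : Disjoint S T) (hSU : Disjoint S U) (hTU : Disjoint T U) :
    mutualEnt S (T ∪ U) ψ ≤ mutualEnt S T ψ + mutualEnt S U ψ := by
  have h : 0 ≤ (∑ z, antiPart (swapOn S) (antiPart (swapOn T) (antiPart (swapOn U)
      (twoCopies ψ))) z * (starRingEnd ℂ) (antiPart (swapOn S) (antiPart (swapOn T)
      (antiPart (swapOn U) (twoCopies ψ))) z)).re := by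
    simp only [Complex.mul_conj, Complex.re_sum, Complex.ofReal_re]
    exact Finset.sum_nonneg fun z _ => Complex.normSq_nonneg _
  rw [sum_antiPart_mul_conj (swapOn_involutive S), antiPart_comm (swapOn_comm S T),
    sum_antiPart_mul_conj (swapOn_involutive T), antiPart_comm (swapOn_comm S U),
    antiPart_comm (swapOn_comm T U), sum_antiPart_mul_conj (swapOn_involutive U)] at h
  simp only [antiPart, sub_mul, Finset.sum_sub_distrib, sum_twoCopies hψ,
    swapOn_swapOn hTU, swapOn_swapOn hST, swapOn_swapOn hSU,
    swapOn_swapOn (Finset.disjoint_union_right.2 ⟨hST, hSU⟩)] at h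
  have h2 : ∀ w : ℂ, (2 * w).re = 2 * w.re := by simp
  simp only [h2, Complex.sub_re, Complex.one_re] at h
  simp only [mutualEnt, purity]
  linarith

theorem mutualEnt_le_sum {ψ : (ι → Fin 2) → ℂ} (hψ : ∑ x, ‖ψ x‖ ^ 2 = 1) {S T : Finset ι}
    (hST : Disjoint S T) : mutualEnt S T ψ ≤ ∑ v ∈ T, mutualEnt S {v} ψ := by
  induction T using Finset.induction_on with
  | empty => simp [mutualEnt, purity_empty hψ]
  | insert v T hv ih =>
    rw [Finset.disjoint_insert_right] at hST
    rw [Finset.sum_insert hv, Finset.insert_eq]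
    exact (mutualEnt_union_le hψ (Finset.disjoint_singleton_right.2 hST.1) hST.2
      (Finset.disjoint_singleton_left.2 hv)).trans (by linarith [ih hST.2])

theorem purity_eq_trSq {I J : Type*} [Fintype I] [Fintype J] {S : Finset ι}
    (e : (ι → Fin 2) ≃ I × J)
    (he : ∀ x y, e (S.piecewise x y) = ((e x).1, (e y).2)) (ψ : (ι → Fin 2) → ℂ) :
    purity S ψ =
      trSq (Matrix.of fun i i' => ∑ j, ψ (e.symm (i, j)) * (starRingEnd ℂ) (ψ (e.symm (i', j)))) := by
  have hs : ∀ i j i' j', S.piecewise (e.symm (i, j)) (e.symm (i', j')) = e.symm (i, j') := by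
    intro i j i' j'
    rw [Equiv.eq_symm_apply, he, Equiv.apply_symm_apply, Equiv.apply_symm_apply]
  simp only [purity, trSq, swapOn, twoCopies, Matrix.trace, Matrix.diag_apply, Matrix.mul_apply,
    Matrix.of_apply, Fintype.sum_prod_type, Finset.sum_mul_sum, map_mul]
  congr 1
  have hsum : ∀ f : (ι → Fin 2) → ℂ, ∑ x, f x = ∑ i, ∑ j, f (e.symm (i, j)) := fun f => by
    rw [← Fintype.sum_prod_type']
    exact (e.symm.sum_comp f).symm
  simp only [hsum, hs]
  refine Finset.sum_congr rfl fun i _ => ?_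
  rw [Finset.sum_comm]
  refine Finset.sum_congr rfl fun i' _ => ?_
  rw [Finset.sum_comm]
  refine Finset.sum_congr rfl fun j _ => Finset.sum_congr rfl fun j' _ => ?_
  ring

end Purity

section Assemble

variable {N : ℕ} {u v : Fin N}

theorem assemble2_left (a c : Fin 2) (f : {i : Fin N // i ≠ u ∧ i ≠ v} → Fin 2) :
    assemble2 u v a c f u = a := by
  simp [assemble2]

theorem assemble2_right (huv : u ≠ v) (a c : Fin 2) (f : {i : Fin N // i ≠ u ∧ i ≠ v} → Fin 2) :
    assemble2 u v a c f v = c := by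
  simp [assemble2, huv.symm]

theorem assemble2_eq {a c : Fin 2} {f : {i : Fin N // i ≠ u ∧ i ≠ v} → Fin 2} {x : Fin N → Fin 2}
    (ha : x u = a) (hc : x v = c) (hf : ∀ i, x i.1 = f i) : assemble2 u v a c f = x := by
  funext i
  unfold assemble2
  split_ifs with h h'
  · rw [h, ha]
  · rw [h', hc]
  · exact (hf ⟨i, h, h'⟩).symm

theorem assemble2_rest (a c : Fin 2) (f : {i : Fin N // i ≠ u ∧ i ≠ v} → Fin 2)
    (i : {i : Fin N // i ≠ u ∧ i ≠ v}) : assemble2 u v a c f i.1 = f i := by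
  simp [assemble2, i.2.1, i.2.2]

/-- Splitting a configuration into the values at `u`, at `v`, and elsewhere. -/
def assembleEquiv (huv : u ≠ v) :
    ({i : Fin N // i ≠ u ∧ i ≠ v} → Fin 2) × Fin 2 × Fin 2 ≃ (Fin N → Fin 2) where
  toFun z := assemble2 u v z.2.1 z.2.2 z.1
  invFun x := (fun i => x i.1, x u, x v)
  left_inv z := by simp only [assemble2_left, assemble2_right huv, assemble2_rest]
  right_inv x := assemble2_eq rfl rfl fun _ => rfl

theorem sum_assemble2 {M : Type*} [AddCommMonoid M] (huv : u ≠ v) (h : (Fin N → Fin 2) → M) :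
    ∑ x, h x = ∑ f, ∑ a, ∑ c, h (assemble2 u v a c f) := by
  rw [← (assembleEquiv huv).sum_comp h, Fintype.sum_prod_type]
  simp only [Fintype.sum_prod_type]
  rfl

theorem rdm2_eq_sum_pureDM (ψ : (Fin N → Fin 2) → ℂ) :
    rdm2 u v ψ = ∑ f, pureDM fun s => ψ (assemble2 u v s.1 s.2 f) := by
  ext s t
  simp only [rdm2, pureDM, Matrix.sum_apply]

theorem sum_norm_assemble2 (huv : u ≠ v) {ψ : (Fin N → Fin 2) → ℂ} (hψ : ∑ x, ‖ψ x‖ ^ 2 = 1) :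
    ∑ f, ∑ s : Fin 2 × Fin 2, ‖ψ (assemble2 u v s.1 s.2 f)‖ ^ 2 = 1 := by
  rw [← hψ, sum_assemble2 huv]
  simp only [Fintype.sum_prod_type]

theorem trace_rdm2 (huv : u ≠ v) {ψ : (Fin N → Fin 2) → ℂ} (hψ : ∑ x, ‖ψ x‖ ^ 2 = 1) :
    (rdm2 u v ψ).trace = 1 := by
  rw [rdm2_eq_sum_pureDM, Matrix.trace_sum]
  simp only [trace_pureDM]
  exact_mod_cast sum_norm_assemble2 huv hψ

theorem swapOn_assemble2_left (a c a' c' : Fin 2)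
    (f g : {i : Fin N // i ≠ u ∧ i ≠ v} → Fin 2) :
    swapOn {u} (assemble2 u v a c f, assemble2 u v a' c' g) =
      (assemble2 u v a' c f, assemble2 u v a c' g) := by
  ext i <;> by_cases h : i = u <;> simp [swapOn, assemble2, h]

theorem swapOn_assemble2_right (huv : u ≠ v) (a c a' c' : Fin 2)
    (f g : {i : Fin N // i ≠ u ∧ i ≠ v} → Fin 2) :
    swapOn {v} (assemble2 u v a c f, assemble2 u v a' c' g) =
      (assemble2 u v a c' f, assemble2 u v a' c g) := by
  ext i <;> by_cases h : i = v <;> simp [swapOn, assemble2, h, huv.symm]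

theorem mutualEnt_le_concA_sq (huv : u ≠ v) {ψ : (Fin N → Fin 2) → ℂ}
    (hψ : ∑ x, ‖ψ x‖ ^ 2 = 1) : mutualEnt {u} {v} ψ ≤ concA (rdm2 u v ψ) ^ 2 := by
  refine le_trans (le_of_eq ?_)
    (sum_detPol_le_concA_sq (rdm2_eq_sum_pureDM ψ) (sum_norm_assemble2 huv hψ))
  have h := sum_norm_antiPart_two hψ (Finset.disjoint_singleton.2 huv)
  have hfg : ∀ f g, ∑ a, ∑ c, ∑ a', ∑ c', ‖antiPart (swapOn {u}) (antiPart (swapOn {v})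
      (twoCopies ψ)) (assemble2 u v a c f, assemble2 u v a' c' g)‖ ^ 2 =
      4 * ‖detPol (coeffMat fun s => ψ (assemble2 u v s.1 s.2 f))
        (coeffMat fun s => ψ (assemble2 u v s.1 s.2 g))‖ ^ 2 := by
    intro f g
    have hac : ∀ a c a' c', ‖antiPart (swapOn {u}) (antiPart (swapOn {v})
        (twoCopies ψ)) (assemble2 u v a c f, assemble2 u v a' c' g)‖ =
        if a ≠ a' ∧ c ≠ c' then ‖detPol (coeffMat fun s => ψ (assemble2 u v s.1 s.2 f))
          (coeffMat fun s => ψ (assemble2 u v s.1 s.2 g))‖ else 0 := by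
      intro a c a' c'
      simp only [antiPart, swapOn_assemble2_left, swapOn_assemble2_right huv, twoCopies]
      split_ifs with hne
      · obtain ⟨ha, hc⟩ := hne
        have hcase : (a = 0 ∧ a' = 1 ∨ a = 1 ∧ a' = 0) ∧ (c = 0 ∧ c' = 1 ∨ c = 1 ∧ c' = 0) := by
          omega
        obtain ⟨⟨rfl, rfl⟩ | ⟨rfl, rfl⟩, ⟨rfl, rfl⟩ | ⟨rfl, rfl⟩⟩ := hcase
        · congr 1; simp only [detPol, coeffMat, Matrix.of_apply]; ring
        · rw [← norm_neg]; congr 1; simp only [detPol, coeffMat, Matrix.of_apply]; ring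
        · rw [← norm_neg]; congr 1; simp only [detPol, coeffMat, Matrix.of_apply]; ring
        · congr 1; simp only [detPol, coeffMat, Matrix.of_apply]; ring
      · rw [norm_eq_zero]
        by_cases ha : a = a'
        · subst ha; ring
        · have hc : c = c' := not_not.1 fun hc => hne ⟨ha, hc⟩
          subst hc; ring
    simp only [hac, Fin.sum_univ_two]
    norm_num
    ring
  have hsum : ∑ z, ‖antiPart (swapOn {u}) (antiPart (swapOn {v}) (twoCopies ψ)) z‖ ^ 2 =
      ∑ f, ∑ g, 4 * ‖detPol (coeffMat fun s => ψ (assemble2 u v s.1 s.2 f))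
        (coeffMat fun s => ψ (assemble2 u v s.1 s.2 g))‖ ^ 2 := by
    rw [Fintype.sum_prod_type, sum_assemble2 huv]
    refine Finset.sum_congr rfl fun f _ => ?_
    simp only [← hfg]
    rw [Finset.sum_comm (s := Finset.univ (α := {i : Fin N // i ≠ u ∧ i ≠ v} → Fin 2))]
    refine Finset.sum_congr rfl fun a _ => ?_
    rw [Finset.sum_comm (s := Finset.univ (α := {i : Fin N // i ≠ u ∧ i ≠ v} → Fin 2))]
    exact Finset.sum_congr rfl fun c _ => sum_assemble2 huv _
  rw [hsum] at h
  simp only [← Finset.mul_sum] at h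
  linarith

theorem rdm2_apply (huv : u ≠ v) (ψ : (Fin N → Fin 2) → ℂ) (s t : Fin 2 × Fin 2) :
    rdm2 u v ψ s t = ∑ x : Fin N → Fin 2, if x u = s.1 ∧ x v = s.2 then
      ψ x * (starRingEnd ℂ) (ψ (Function.update (Function.update x u t.1) v t.2)) else 0 := by
  rw [sum_assemble2 huv]
  simp only [rdm2, assemble2_left, assemble2_right huv]
  refine Finset.sum_congr rfl fun f _ => ?_
  have hup : ∀ a c, Function.update (Function.update (assemble2 u v a c f) u t.1) v t.2 =
      assemble2 u v t.1 t.2 f := fun a c => by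
    symm
    refine assemble2_eq ?_ ?_ fun i => ?_
    · simp [huv]
    · simp
    · rw [Function.update_of_ne i.2.2, Function.update_of_ne i.2.1, assemble2_rest]
  simp only [hup]
  rw [Finset.sum_eq_single s.1, Finset.sum_eq_single s.2] <;> simp +contextual

end Assemble

section Split

variable {n : ℕ} {u v : Fin (n + 2)} {ψ : (Fin (n + 2) → Fin 2) → ℂ}

/-- The vector `ψ` as a family indexed by the values at `v`, at `u` and elsewhere. -/
def splitVec (e : (Fin (n + 2) → Fin 2) ≃ Fin 2 × Fin 2 × (Fin n → Fin 2))
    (ψ : (Fin (n + 2) → Fin 2) → ℂ) (b a : Fin 2) (c : Fin n → Fin 2) : ℂ := ψ (e.symm (a, b, c))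

theorem rdm2_eq_sum_pairDM (huv : u ≠ v) (hu : ∀ i : Fin n, i.succ.succ ≠ u)
    (hv : ∀ i : Fin n, i.succ.succ ≠ v)
    (e : (Fin (n + 2) → Fin 2) ≃ Fin 2 × Fin 2 × (Fin n → Fin 2))
    (he : ∀ x, e x = (x u, x v, fun i => x i.succ.succ)) (i : Fin n) :
    rdm2 u i.succ.succ ψ = ∑ b, pairDM (splitVec e ψ b) i := by
  ext s t
  rw [rdm2_apply (hu i).symm, ← e.symm.sum_comp, Fintype.sum_prod_type]
  simp only [Fintype.sum_prod_type, Matrix.sum_apply, pairDM, Matrix.of_apply, splitVec]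
  have hc : ∀ a b c, e.symm (a, b, c) u = a ∧ e.symm (a, b, c) v = b ∧
      ∀ j : Fin n, e.symm (a, b, c) j.succ.succ = c j := by
    intro a b c
    have h := he (e.symm (a, b, c))
    rw [Equiv.apply_symm_apply, Prod.mk.injEq, Prod.mk.injEq] at h
    exact ⟨h.1.symm, h.2.1.symm, fun j => (congrFun h.2.2 j).symm⟩
  have hup : ∀ a b c, Function.update (Function.update (e.symm (a, b, c)) u t.1) i.succ.succ t.2 =
      e.symm (t.1, b, Function.update c i t.2) := by
    intro a b c
    rw [Equiv.eq_symm_apply, he]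
    refine Prod.ext ?_ (Prod.ext ?_ (funext fun j => ?_))
    · simp [Function.update_of_ne (hu i).symm]
    · simp [Function.update_of_ne (hv i).symm, Function.update_of_ne huv.symm, (hc a b c).2.1]
    · by_cases h : j = i
      · simp [h]
      · have h' : j.succ.succ ≠ i.succ.succ := fun h' => h (Fin.succ_injective _ (Fin.succ_injective _ h'))
        simp [h, Function.update_of_ne (hu j), (hc a b c).2.2 j]
  simp only [hup, (hc _ _ _).1, (hc _ _ _).2.2]
  rw [Finset.sum_eq_single s.1] <;> simp +contextual

theorem union_compl_pair {ι : Type*} [Fintype ι] [DecidableEq ι] {u v : ι} (huv : u ≠ v) :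
    ({v} ∪ {u, v}ᶜ : Finset ι) = {u}ᶜ := by
  ext i
  simp only [Finset.mem_union, Finset.mem_singleton, Finset.mem_compl, Finset.mem_insert]
  by_cases h : i = v
  · simp [h, huv.symm]
  · simp [h]

theorem sum_conc_sq_le (huv : u ≠ v) (hu : ∀ i : Fin n, i.succ.succ ≠ u)
    (hv : ∀ i : Fin n, i.succ.succ ≠ v)
    (e : (Fin (n + 2) → Fin 2) ≃ Fin 2 × Fin 2 × (Fin n → Fin 2))
    (he : ∀ x, e x = (x u, x v, fun i => x i.succ.succ)) (hψ : ∑ x, ‖ψ x‖ ^ 2 = 1) :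
    ∑ i : Fin n, conc (rdm2 u i.succ.succ ψ) ^ 2 ≤
      3 * (1 - purity {u, v} ψ) + (1 - purity {v} ψ) - (1 - purity {u} ψ) := by
  have hpu : purity {u} ψ = trSq (∑ b, gramMat (splitVec e ψ b)) := by
    rw [purity_eq_trSq e (fun x y => ?_)]
    · congr 1
      ext a a'
      simp only [Matrix.of_apply, Matrix.sum_apply, gramMat, splitVec, Fintype.sum_prod_type]
    · rw [he, he, he]
      simp [huv.symm, hu]
  have hpv : purity {v} ψ =
      trSq (gramMat fun b (p : Fin 2 × (Fin n → Fin 2)) => splitVec e ψ b p.1 p.2) := by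
    let e' : (Fin (n + 2) → Fin 2) ≃ Fin 2 × Fin 2 × (Fin n → Fin 2) :=
      e.trans ⟨fun z => (z.2.1, z.1, z.2.2), fun z => (z.2.1, z.1, z.2.2), fun _ => rfl, fun _ => rfl⟩
    rw [purity_eq_trSq e' (fun x y => ?_)]
    · rfl
    · simp only [e', Equiv.trans_apply, he, Equiv.coe_fn_mk]
      simp [huv, hv]
  have hpuv : purity {u, v} ψ = trSq (∑ b, envMat (splitVec e ψ b)) := by
    let e' : (Fin (n + 2) → Fin 2) ≃ (Fin n → Fin 2) × Fin 2 × Fin 2 :=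
      e.trans ⟨fun z => (z.2.2, z.2.1, z.1), fun z => (z.2.2, z.2.1, z.1), fun _ => rfl, fun _ => rfl⟩
    rw [← purity_compl, purity_eq_trSq e' (fun x y => ?_)]
    · congr 1
      ext c c'
      simp only [Matrix.of_apply, Matrix.sum_apply, envMat, splitVec, Fintype.sum_prod_type]
      rfl
    · simp only [e', Equiv.trans_apply, he, Equiv.coe_fn_mk, Finset.piecewise_compl]
      simp [hu, hv]
  have hsub := mutualEnt_nonneg hψ (S := {v}) (T := {u, v}ᶜ) (by simp)
  rw [mutualEnt, union_compl_pair huv, purity_compl, purity_compl, hpu, hpv, hpuv] at hsub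
  rw [hpu, hpv, hpuv]
  obtain ⟨r, hr, hle⟩ := exists_hasDecomp_sum_sq_le (splitVec e ψ) (by
    rw [← hψ, ← e.symm.sum_comp, Fintype.sum_prod_type]
    simp only [Fintype.sum_prod_type, splitVec]
    exact Finset.sum_comm) (by linarith)
  refine le_trans (Finset.sum_le_sum fun i _ => ?_) hle
  have hi := hr i
  rw [← rdm2_eq_sum_pairDM huv hu hv e he] at hi
  exact pow_le_pow_left₀ (conc_nonneg _) (hi.conc_le (trace_rdm2 (hu i).symm hψ)) 2

theorem sum_conc_sq_sub_sum_concA_sq_le (huv : u ≠ v) (hu : ∀ i : Fin n, i.succ.succ ≠ u)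
    (hv : ∀ i : Fin n, i.succ.succ ≠ v)
    (e : (Fin (n + 2) → Fin 2) ≃ Fin 2 × Fin 2 × (Fin n → Fin 2))
    (he : ∀ x, e x = (x u, x v, fun i => x i.succ.succ)) (hψ : ∑ x, ‖ψ x‖ ^ 2 = 1) :
    ∑ i : Fin n, conc (rdm2 u i.succ.succ ψ) ^ 2 - ∑ i : Fin n, concA (rdm2 v i.succ.succ ψ) ^ 2 ≤
      2 * (1 - purity {u, v} ψ) := by
  have hle := sum_conc_sq_le huv hu hv e he hψ
  have hsub := mutualEnt_le_sum hψ (S := {v})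
    (T := {u, v}ᶜ) (by simp)
  have himg : ({u, v}ᶜ : Finset (Fin (n + 2))) =
      Finset.univ.map ((Fin.succEmb n).trans (Fin.succEmb (n + 1))) := by
    symm
    refine Finset.eq_of_subset_of_card_le (fun j hj => ?_) ?_
    · simp only [Finset.mem_map, Finset.mem_univ, true_and] at hj
      obtain ⟨i, rfl⟩ := hj
      simpa using ⟨hu i, hv i⟩
    · rw [Finset.card_compl, Finset.card_pair huv]
      simp
  rw [mutualEnt, union_compl_pair huv, purity_compl, purity_compl, himg, Finset.sum_map] at hsub
  have hsum : ∑ i : Fin n, mutualEnt {v} {i.succ.succ} ψ ≤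
      ∑ i : Fin n, concA (rdm2 v i.succ.succ ψ) ^ 2 :=
    Finset.sum_le_sum fun i _ => mutualEnt_le_concA_sq (hv i).symm hψ
  simp only [Function.Embedding.trans_apply, Fin.coe_succEmb] at hsub
  linarith

end Split

/-- Splitting off the first two coordinates. -/
def consConsEquiv (n : ℕ) : (Fin (n + 2) → Fin 2) ≃ Fin 2 × Fin 2 × (Fin n → Fin 2) where
  toFun x := (x 0, x 1, fun i => x i.succ.succ)
  invFun z := Fin.cons z.1 (Fin.cons z.2.1 z.2.2)
  left_inv x := by
    funext i
    refine Fin.cases rfl (fun i => Fin.cases rfl (fun i => rfl) i) i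
  right_inv z := rfl

theorem qubitCut_sq {N : ℕ} (P : Fin N → Prop) [DecidablePred P] {ψ : (Fin N → Fin 2) → ℂ}
    (hψ : ∑ x, ‖ψ x‖ ^ 2 = 1) :
    qubitCut P ψ ^ 2 = 2 * (1 - purity (Finset.univ.filter P) ψ) := by
  have hp : purity (Finset.univ.filter P) ψ = trSq (ptraceRight (pureDM
      fun x : ({i // P i} → Fin 2) × ({i // ¬ P i} → Fin 2) =>
        ψ ((Equiv.piEquivPiSubtypeProd P (fun _ => Fin 2)).symm x))) := by
    rw [purity_eq_trSq (Equiv.piEquivPiSubtypeProd P fun _ => Fin 2) fun x y => ?_]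
    · rfl
    · refine Prod.ext (funext fun i => ?_) (funext fun i => ?_)
      · simp [i.2]
      · simp [i.2]
  have h := mutualEnt_nonneg hψ (disjoint_compl_right (a := Finset.univ.filter P))
  rw [mutualEnt, purity_compl, Finset.union_compl, purity_univ hψ] at h
  rw [qubitCut, pureConc, ← hp, Real.sq_sqrt (by linarith)]

/-- Corollary 1 of the paper: monogamy lower bound for the concurrence across
the cut `ABC₁ | C₂…C_{N-2}`.  Qubits: `A = 0`, `B = 1`, `C₁ = 2`, and
`C_i = i + 1` for `i = 1, …, N - 2`. -/
theorem corollary1_lower_bound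
    (N : ℕ) (hN : 4 ≤ N) (ψ : (Fin N → Fin 2) → ℂ)
    (hψ : ∑ x, ‖ψ x‖ ^ 2 = 1) :
    (qubitCut (fun i : Fin N => (i : ℕ) < 3) ψ) ^ 2 ≥
      max
        (∑ i : Fin (N - 2), (conc (rdm2 (⟨0, by omega⟩ : Fin N) (⟨(i : ℕ) + 2, by have := i.isLt; omega⟩ : Fin N) ψ)) ^ 2 -
          ∑ i : Fin (N - 2), (concA (rdm2 (⟨1, by omega⟩ : Fin N) (⟨(i : ℕ) + 2, by have := i.isLt; omega⟩ : Fin N) ψ)) ^ 2)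
        (∑ i : Fin (N - 2), (conc (rdm2 (⟨1, by omega⟩ : Fin N) (⟨(i : ℕ) + 2, by have := i.isLt; omega⟩ : Fin N) ψ)) ^ 2 -
          ∑ i : Fin (N - 2), (concA (rdm2 (⟨0, by omega⟩ : Fin N) (⟨(i : ℕ) + 2, by have := i.isLt; omega⟩ : Fin N) ψ)) ^ 2) -
      ∑ j ∈ Finset.univ \ {(⟨2, by omega⟩ : Fin N)}, (concA (rdm2 (⟨2, by omega⟩ : Fin N) j ψ)) ^ 2 := by
  obtain ⟨n, rfl⟩ : ∃ n, N = n + 2 := ⟨N - 2, by omega⟩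
  have h0 : ∀ i : Fin n, i.succ.succ ≠ 0 := fun i => Fin.succ_ne_zero _
  have h1 : ∀ i : Fin n, i.succ.succ ≠ 1 := fun i h => Fin.succ_ne_zero i (Fin.succ_injective _ h)
  have hA := sum_conc_sq_sub_sum_concA_sq_le (ψ := ψ) (Fin.zero_ne_one) h0 h1 (consConsEquiv n)
    (fun _ => rfl) hψ
  have hB := sum_conc_sq_sub_sum_concA_sq_le (ψ := ψ) (Fin.zero_ne_one.symm) h1 h0
    ((consConsEquiv n).trans ⟨fun z => (z.2.1, z.1, z.2.2), fun z => (z.2.1, z.1, z.2.2),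
      fun _ => rfl, fun _ => rfl⟩) (fun _ => rfl) hψ
  rw [Finset.pair_comm] at hB
  have hmax := max_le hA hB
  set c : Fin (n + 2) := ⟨2, by omega⟩ with hc
  have hC := mutualEnt_le_sum hψ (disjoint_compl_right (a := {c}))
  rw [mutualEnt, Finset.union_compl, purity_compl, purity_univ hψ] at hC
  have hC' : ∑ j ∈ {c}ᶜ, mutualEnt {c} {j} ψ ≤
      ∑ j ∈ Finset.univ \ {c}, concA (rdm2 c j ψ) ^ 2 :=
    Finset.sum_le_sum fun j hj => mutualEnt_le_concA_sq (by simpa [eq_comm] using hj) hψ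
  have hcut := mutualEnt_nonneg hψ
    (S := (Finset.univ.filter fun i : Fin (n + 2) => (i : ℕ) < 3)ᶜ) (T := {c}) (by simp [hc])
  have hun : ((Finset.univ.filter fun i : Fin (n + 2) => (i : ℕ) < 3)ᶜ ∪ {c}) =
      ({0, 1}ᶜ : Finset (Fin (n + 2))) := by
    ext i
    simp only [Finset.mem_union, Finset.mem_compl, Finset.mem_filter, Finset.mem_univ, true_and,
      Finset.mem_singleton, Finset.mem_insert, Fin.ext_iff, hc, Fin.val_zero, Fin.val_one]
    omega
  rw [mutualEnt, hun, purity_compl, purity_compl] at hcut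
  rw [qubitCut_sq _ hψ, ge_iff_le]
  refine (sub_le_sub_right hmax _).trans ?_
  linarith

end
end
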